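/- arXiv:1802.01210 — 3 statements merged into one kernel-verified Lean document; each statement's English description precedes it below -/
import Mathlib

section
/- Let X be a hypersurface of degree d and dimension n in P^{n+1} over F_q with 0 < k_X ≤ n−1, and suppose N_q(X) = Θ_{n,k_X}^{d,q}. If p is a nonsingular F_q-point of X, then N_q(X ∩ T_pX) = (d−1)·q^{k_X}·N_q(P^{(n−1)−k_X}) + N_q(P^{k_X}) = Θ_{n−1,k_X}^{d,q}. -/
/-- `NP q N` is the number of `F_q`-points of `P^N`, i.e. `q^N + q^(N-1) + … + q + 1`. -/
def NP (q N : ℕ) : ℕ := ∑ i ∈ Finset.range (N + 1), q ^ i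

/-- `Theta q d n k` is the quantity `Θ_{n,k}^{d,q} = (d-1)·q^k·N_q(P^{n-k}) + N_q(P^k)`. -/
def Theta (q d n k : ℕ) : ℕ := (d - 1) * q ^ k * NP q (n - k) + NP q k

/-- The number of `F`-rational points of the hypersurface `f = 0` in `P^{m-1}`. -/
noncomputable def numPoints {F : Type*} [Field F] {m : ℕ}
    (f : MvPolynomial (Fin m) F) : ℕ :=
  Nat.card {p : Projectivization F (Fin m → F) // MvPolynomial.eval p.rep f = 0}

/-- The projective linear subspace `P(W)` is contained in the hypersurface `f = 0`. -/
def SubInX {F : Type*} [Field F] {m : ℕ}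
    (f : MvPolynomial (Fin m) F) (W : Submodule F (Fin m → F)) : Prop :=
  ∀ v ∈ W, MvPolynomial.eval v f = 0

/-- The Thas invariant of the hypersurface `f = 0` equals `k`: there is an `F`-linear
projective subspace of dimension `k` contained in it, and none of dimension `k + 1`. -/
def ThasEq {F : Type*} [Field F] {m : ℕ}
    (f : MvPolynomial (Fin m) F) (k : ℕ) : Prop :=
  (∃ W : Submodule F (Fin m → F), Module.finrank F W = k + 1 ∧ SubInX f W) ∧
  ¬ ∃ W : Submodule F (Fin m → F), Module.finrank F W = k + 2 ∧ SubInX f W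

/-- `v` is a homogeneous coordinate vector of a singular `F`-point of `f = 0`. -/
def IsSingPt {F : Type*} [Field F] {m : ℕ}
    (f : MvPolynomial (Fin m) F) (v : Fin m → F) : Prop :=
  v ≠ 0 ∧ MvPolynomial.eval v f = 0 ∧
    ∀ i, MvPolynomial.eval v (MvPolynomial.pderiv i f) = 0

/-- The pullback of `f` along the linear map sending the `i`-th basis vector to `b i`. -/
noncomputable def linPullback {F : Type*} [Field F] {m r : ℕ} (b : Fin r → Fin m → F)
    (f : MvPolynomial (Fin m) F) : MvPolynomial (Fin r) F :=
  MvPolynomial.aeval (fun l => ∑ i, MvPolynomial.C (b i l) * MvPolynomial.X i) f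

theorem eval_linPullback {F : Type*} [Field F] {m r : ℕ} (b : Fin r → Fin m → F)
    (f : MvPolynomial (Fin m) F) (a : Fin r → F) :
    MvPolynomial.eval a (linPullback b f) = MvPolynomial.eval (∑ i, a i • b i) f := by
  unfold linPullback
  induction f using MvPolynomial.induction_on with
  | C c => simp
  | add p q hp hq => simp only [map_add, hp, hq]
  | mul_X p l hp =>
    simp only [map_mul, hp, MvPolynomial.aeval_X, MvPolynomial.eval_X, map_sum,
      MvPolynomial.eval_C, Finset.sum_apply, Pi.smul_apply, smul_eq_mul, mul_comm (b _ l)]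

theorem isHomogeneous_linPullback {F : Type*} [Field F] {m r d : ℕ} (b : Fin r → Fin m → F)
    {f : MvPolynomial (Fin m) F} (hf : f.IsHomogeneous d) :
    (linPullback b f).IsHomogeneous d := by
  have h := hf.aeval (fun l => ∑ i, MvPolynomial.C (b i l) * MvPolynomial.X i) (n := 1)
    (fun l => MvPolynomial.IsHomogeneous.sum _ _ _ fun i _ => by
      simpa using (MvPolynomial.isHomogeneous_C _ (b i l)).mul (MvPolynomial.isHomogeneous_X F i))
  simpa [linPullback] using h

theorem linPullback_eq_zero {F : Type*} [Field F] [Fintype F] {m r d : ℕ}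
    (b : Fin r → Fin m → F) {f : MvPolynomial (Fin m) F} (hf : f.IsHomogeneous d)
    (hdq : d ≤ Fintype.card F) (h : ∀ a : Fin r → F, MvPolynomial.eval (∑ i, a i • b i) f = 0) :
    linPullback b f = 0 := by
  refine (isHomogeneous_linPullback b hf).eq_zero_of_forall_eval_eq_zero_of_le_card
    (fun a => by rw [eval_linPullback, h]) ?_
  rw [Cardinal.mk_fintype]
  exact_mod_cast hdq

theorem eval_smul_eq {F : Type*} [Field F] {m d : ℕ} {f : MvPolynomial (Fin m) F}
    (hf : f.IsHomogeneous d) (c : F) (x : Fin m → F) :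
    MvPolynomial.eval (c • x) f = c ^ d * MvPolynomial.eval x f := by
  rw [MvPolynomial.eval_eq, MvPolynomial.eval_eq, Finset.mul_sum]
  refine Finset.sum_congr rfl fun s hs => ?_
  have hdeg : ∑ i, s i = d := by
    rw [← hf (MvPolynomial.mem_support_iff.1 hs), Finsupp.weight_apply, Finsupp.sum_fintype] <;> simp
  simp only [Pi.smul_apply, smul_eq_mul, mul_pow]
  rw [Finset.prod_mul_distrib]
  have : ∏ i ∈ s.support, c ^ s i = c ^ d := by
    rw [Finset.prod_pow_eq_pow_sum, ← hdeg]
    congr 1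
    exact Finset.sum_subset (Finset.subset_univ _) (by simp)
  rw [this]; ring

theorem pderiv_linPullback {F : Type*} [Field F] {m r : ℕ} (b : Fin r → Fin m → F)
    (f : MvPolynomial (Fin m) F) (i : Fin r) :
    MvPolynomial.pderiv i (linPullback b f) =
      ∑ l, linPullback b (MvPolynomial.pderiv l f) * MvPolynomial.C (b i l) := by
  unfold linPullback
  induction f using MvPolynomial.induction_on with
  | C c => simp
  | add p q hp hq => simp only [map_add, hp, hq, add_mul, Finset.sum_add_distrib]
  | mul_X p l hp =>
    simp only [map_mul, MvPolynomial.aeval_X, MvPolynomial.pderiv_mul, map_add, hp, add_mul,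
      Finset.sum_add_distrib]
    congr 1
    · rw [Finset.sum_mul]
      exact Finset.sum_congr rfl fun _ _ => by ring
    · rw [Finset.sum_eq_single l]
      · congr 1
        · simp
        · simp [MvPolynomial.pderiv_X, Pi.single_apply]
      · intro j _ hj
        simp [MvPolynomial.pderiv_X_of_ne hj.symm]
      · simp

theorem card_affine_zeros_le {F : Type*} [Field F] [Fintype F] [DecidableEq F] {m r d : ℕ}
    {f : MvPolynomial (Fin m) F} (hf : f.IsHomogeneous d) (hdq : d ≤ Fintype.card F)
    (b : Fin r → Fin m → F) (y : Fin m → F)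
    (hb : ∀ a : Fin r → F, MvPolynomial.eval (∑ i, a i • b i) f = 0)
    (hy : ∃ a : Fin r → F, MvPolynomial.eval (y + ∑ i, a i • b i) f ≠ 0) :
    Fintype.card F * (Finset.univ.filter fun a : Fin r → F =>
      MvPolynomial.eval (y + ∑ i, a i • b i) f = 0).card ≤ (d - 1) * Fintype.card F ^ r := by
  set p := linPullback (Fin.cons y b : Fin (r + 1) → Fin m → F) f with hp
  have hph : p.IsHomogeneous d := isHomogeneous_linPullback _ hf
  set P := MvPolynomial.finSuccEquiv F r p with hP
  have hPdeg : P.natDegree ≤ d := by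
    rw [hP, MvPolynomial.natDegree_finSuccEquiv]
    exact (MvPolynomial.degreeOf_le_totalDegree _ _).trans hph.totalDegree_le
  have heval : ∀ (a : Fin r → F) (t : F),
      Polynomial.eval t (P.map (MvPolynomial.eval a)) =
        MvPolynomial.eval (t • y + ∑ i, a i • b i) f := by
    intro a t
    rw [hP, ← MvPolynomial.eval_eq_eval_mv_eval', hp, eval_linPullback, Fin.sum_univ_succ]
    simp
  have h0 : P.coeff 0 = 0 := by
    refine (hph.finSuccEquiv_coeff_isHomogeneous 0 d (zero_add d)
      ).eq_zero_of_forall_eval_eq_zero_of_le_card (fun a => ?_) ?_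
    · have := heval a 0
      rw [← Polynomial.coeff_zero_eq_eval_zero, Polynomial.coeff_map] at this
      rw [← hP, this, zero_smul, zero_add, hb]
    · rw [Cardinal.mk_fintype]
      exact_mod_cast hdq
  set H := P.eval 1 with hH
  have hHe : ∀ a : Fin r → F,
      MvPolynomial.eval a H = MvPolynomial.eval (y + ∑ i, a i • b i) f := by
    intro a
    have := heval a 1
    rw [one_smul] at this
    rw [← this, Polynomial.eval_one_map]
  have hHdeg : H.totalDegree ≤ d - 1 := by
    rw [hH, Polynomial.eval_eq_sum_range' (Nat.lt_succ_of_le hPdeg)]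
    refine MvPolynomial.totalDegree_finsetSum_le fun i hi => ?_
    rw [one_pow, mul_one]
    rcases Nat.eq_zero_or_pos i with rfl | hi0
    · simp [h0]
    · have := (hph.finSuccEquiv_coeff_isHomogeneous i (d - i)
        (by have := Finset.mem_range.1 hi; omega)).totalDegree_le
      exact this.trans (by omega)
  have hHne : H ≠ 0 := by
    rintro h
    obtain ⟨a, ha⟩ := hy
    exact ha (by rw [← hHe, h, map_zero])
  have hq : 0 < Fintype.card F := Fintype.card_pos
  have sz := MvPolynomial.schwartz_zippel_totalDegree hHne (Finset.univ : Finset F)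
  rw [div_le_div_iff₀ (by rw [Finset.card_univ]; positivity)
    (by rw [Finset.card_univ]; positivity)] at sz
  simp only [Fintype.piFinset_univ, hHe, Finset.card_univ] at sz
  have hnat : (Finset.univ.filter fun a : Fin r → F =>
      MvPolynomial.eval (y + ∑ i, a i • b i) f = 0).card * Fintype.card F ≤
      H.totalDegree * Fintype.card F ^ r := by exact_mod_cast sz
  rw [mul_comm]
  exact hnat.trans (Nat.mul_le_mul_right _ hHdeg)

theorem tangent_of_line {F : Type*} [Field F] [Fintype F] {m d : ℕ}
    {f : MvPolynomial (Fin m) F} (hf : f.IsHomogeneous d) (hdq : d ≤ Fintype.card F)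
    {W : Submodule F (Fin m → F)} (hW : SubInX f W) {v w : Fin m → F} (hv : v ∈ W) (hw : w ∈ W) :
    ∑ i, MvPolynomial.eval v (MvPolynomial.pderiv i f) * w i = 0 := by
  have h0 : linPullback ![v, w] f = 0 := linPullback_eq_zero _ hf hdq fun a => hW _ <| by
    simpa using W.add_mem (W.smul_mem _ hv) (W.smul_mem _ hw)
  have h1 := congrArg (MvPolynomial.eval ![1, 0]) (pderiv_linPullback ![v, w] f 1)
  simpa [h0, eval_linPullback] using h1.symm

theorem subInX_sup_span_singleton {F : Type*} [Field F] {m d : ℕ} {f : MvPolynomial (Fin m) F}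
    (hf : f.IsHomogeneous d) {W : Submodule F (Fin m → F)} (hW : SubInX f W) {y : Fin m → F}
    (hy : ∀ w ∈ W, MvPolynomial.eval (y + w) f = 0) :
    SubInX f (W ⊔ Submodule.span F {y}) := by
  intro x hx
  obtain ⟨w, hw, z, hz, rfl⟩ := Submodule.mem_sup.1 hx
  obtain ⟨t, rfl⟩ := Submodule.mem_span_singleton.1 hz
  by_cases ht : t = 0
  · simpa [ht] using hW w hw
  · have : w + t • y = t • (y + t⁻¹ • w) := by
      rw [smul_add, smul_inv_smul₀ ht, add_comm]
    rw [this, eval_smul_eq hf, hy _ (W.smul_mem _ hw), mul_zero]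

theorem finrank_quotient_eq {F : Type*} [Field F] {m r : ℕ} {W : Submodule F (Fin m → F)}
    (hr : Module.finrank F W = r) : Module.finrank F ((Fin m → F) ⧸ W) + r = m := by
  have := W.finrank_quotient_add_finrank
  rwa [hr, Module.finrank_fin_fun] at this

section PointCounts

open Classical

variable {F : Type*} [Field F] [Fintype F]

theorem card_zeros_coset_le {m r d : ℕ} {f : MvPolynomial (Fin m) F} (hf : f.IsHomogeneous d)
    (hdq : d ≤ Fintype.card F) {W : Submodule F (Fin m → F)} (hr : Module.finrank F W = r)
    (hW : SubInX f W) {y : Fin m → F} (hy : ∃ w ∈ W, MvPolynomial.eval (y + w) f ≠ 0) :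
    Fintype.card F * (Finset.univ.filter fun x : Fin m → F =>
      W.mkQ x = W.mkQ y ∧ MvPolynomial.eval x f = 0).card ≤ (d - 1) * Fintype.card F ^ r := by
  let B := Module.finBasisOfFinrankEq F W hr
  have hB : ∀ w ∈ W, ∃ a : Fin r → F, ∑ i, a i • (B i : Fin m → F) = w := fun w hw =>
    ⟨B.repr ⟨w, hw⟩, by
      have h := congrArg W.subtype (B.sum_repr ⟨w, hw⟩)
      rwa [map_sum] at h⟩
  have key := card_affine_zeros_le hf hdq (fun i => (B i : Fin m → F)) y
    (fun a => hW _ (W.sum_mem fun i _ => W.smul_mem _ (B i).2)) (by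
      obtain ⟨w, hw, h⟩ := hy
      obtain ⟨a, rfl⟩ := hB w hw
      exact ⟨a, h⟩)
  refine le_trans (Nat.mul_le_mul_left _ (Finset.card_le_card_of_surjOn
    (fun a => y + ∑ i, a i • (B i : Fin m → F)) ?_)) key
  intro x hx
  simp only [Finset.coe_filter, Finset.mem_univ, true_and, Set.mem_ofPred_eq] at hx
  have hxy : x - y ∈ W := by
    simpa using (Submodule.Quotient.eq W).1 hx.1
  obtain ⟨a, ha⟩ := hB _ hxy
  have hxa : y + ∑ i, a i • (B i : Fin m → F) = x := by rw [ha]; abel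
  refine ⟨a, ?_, hxa⟩
  simp only [Finset.coe_filter, Finset.mem_univ, true_and, Set.mem_ofPred_eq, hxa, hx.2]

theorem card_zeros_eq_sum_cosets {m r : ℕ} {f : MvPolynomial (Fin m) F}
    {W : Submodule F (Fin m → F)} (hr : Module.finrank F W = r) (hW : SubInX f W)
    (K : Submodule F ((Fin m → F) ⧸ W)) :
    (Finset.univ.filter fun x : Fin m → F => W.mkQ x ∈ K ∧ MvPolynomial.eval x f = 0).card =
      Fintype.card F ^ r + ∑ c ∈ (Finset.univ.filter (· ∈ K)).erase 0,
        (Finset.univ.filter fun x : Fin m → F =>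
          W.mkQ x = c ∧ MvPolynomial.eval x f = 0).card := by
  rw [Finset.card_eq_sum_card_fiberwise (f := W.mkQ) (t := Finset.univ.filter (· ∈ K))
    (fun x hx => by simpa using (Finset.mem_filter.1 hx).2.1),
    ← Finset.add_sum_erase _ _ (a := 0) (by simp)]
  congr 1
  · rw [← hr, ← Module.card_eq_pow_finrank (K := F) (V := W), Fintype.card_subtype]
    congr 1
    ext x
    simp only [Finset.mem_filter, Finset.mem_univ, true_and]
    have hx : W.mkQ x = 0 ↔ x ∈ W := Submodule.Quotient.mk_eq_zero W
    exact ⟨fun h => hx.1 h.2, fun h => ⟨⟨hx.2 h ▸ K.zero_mem, hW x h⟩, hx.2 h⟩⟩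
  · refine Finset.sum_congr rfl fun c hc => ?_
    congr 1
    ext x
    simp only [Finset.mem_erase, Finset.mem_filter, Finset.mem_univ, true_and] at hc ⊢
    constructor
    · rintro ⟨⟨_, h⟩, rfl⟩
      exact ⟨rfl, h⟩
    · rintro ⟨rfl, h⟩
      exact ⟨⟨hc.2, h⟩, rfl⟩

theorem card_erase_zero_add_one {V : Type*} [AddCommGroup V] [Module F V] [Fintype V]
    (K : Submodule F V) :
    ((Finset.univ.filter (· ∈ K)).erase 0).card + 1 = Fintype.card F ^ Module.finrank F K := by
  rw [Finset.card_erase_add_one (by simp), ← Module.card_eq_pow_finrank (K := F) (V := K),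
    Fintype.card_subtype]

/-- The coset bound on the zeros outside `W`, for a subspace `W` of the zero set which is not
contained in a larger one. -/
theorem card_zeros_coset_le_of_maximal {m j d : ℕ} {f : MvPolynomial (Fin m) F}
    (hf : f.IsHomogeneous d) (hdq : d ≤ Fintype.card F) {W : Submodule F (Fin m → F)}
    (hr : Module.finrank F W = j + 1) (hW : SubInX f W)
    (hmax : ¬ ∃ U : Submodule F (Fin m → F), W ≤ U ∧ Module.finrank F U = j + 2 ∧ SubInX f U)
    {c : (Fin m → F) ⧸ W} (hc : c ≠ 0) :
    (Finset.univ.filter fun x : Fin m → F => W.mkQ x = c ∧ MvPolynomial.eval x f = 0).card ≤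
      (d - 1) * Fintype.card F ^ j := by
  obtain ⟨y, rfl⟩ := W.mkQ_surjective c
  have hyW : y ∉ W := fun h => hc (by simpa using h)
  have hy : ∃ w ∈ W, MvPolynomial.eval (y + w) f ≠ 0 := by
    by_contra! h
    refine hmax ⟨W ⊔ Submodule.span F {y}, le_sup_left, ?_, subInX_sup_span_singleton hf hW h⟩
    rw [Submodule.finrank_sup_span_singleton hyW, hr]
  have := card_zeros_coset_le hf hdq hr hW hy
  rw [pow_succ, ← mul_assoc, mul_comm] at this
  exact Nat.le_of_mul_le_mul_right this Fintype.card_pos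

theorem card_zeros_add_le {m j d : ℕ} {f : MvPolynomial (Fin m) F}
    (hf : f.IsHomogeneous d) (hdq : d ≤ Fintype.card F) {W : Submodule F (Fin m → F)}
    (hr : Module.finrank F W = j + 1) (hW : SubInX f W)
    (hmax : ¬ ∃ U : Submodule F (Fin m → F), W ≤ U ∧ Module.finrank F U = j + 2 ∧ SubInX f U) :
    (Finset.univ.filter fun x : Fin m → F => MvPolynomial.eval x f = 0).card +
      (d - 1) * Fintype.card F ^ j ≤
      Fintype.card F ^ (j + 1) + (d - 1) * Fintype.card F ^ (m - 1) := by
  have h := card_zeros_eq_sum_cosets hr hW ⊤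
  simp only [Submodule.mem_top, true_and] at h
  have hs := Finset.sum_le_card_nsmul ((Finset.univ.filter
    (· ∈ (⊤ : Submodule F ((Fin m → F) ⧸ W)))).erase 0) _ _
    fun c hc => card_zeros_coset_le_of_maximal hf hdq hr hW hmax (Finset.ne_of_mem_erase hc)
  have hcard := card_erase_zero_add_one (⊤ : Submodule F ((Fin m → F) ⧸ W))
  rw [finrank_top] at hcard
  have hm := finrank_quotient_eq hr
  simp only [Submodule.mem_top, smul_eq_mul] at hs hcard
  rw [h]
  have hp : (d - 1) * Fintype.card F ^ (m - 1) =
      Fintype.card F ^ Module.finrank F ((Fin m → F) ⧸ W) * ((d - 1) * Fintype.card F ^ j) := by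
    have : m - 1 = Module.finrank F ((Fin m → F) ⧸ W) + j := by omega
    rw [this, pow_add]; ring
  rw [hp, ← hcard, add_mul, one_mul]
  omega

/-- If a maximal subspace `W` of the zero set attains equality in `card_zeros_add_le`, then the
zeros on every subspace through `W` are counted exactly. -/
theorem card_zeros_comap_add_eq {m j d : ℕ} {f : MvPolynomial (Fin m) F}
    (hf : f.IsHomogeneous d) (hdq : d ≤ Fintype.card F) {W : Submodule F (Fin m → F)}
    (hr : Module.finrank F W = j + 1) (hW : SubInX f W)
    (hmax : ¬ ∃ U : Submodule F (Fin m → F), W ≤ U ∧ Module.finrank F U = j + 2 ∧ SubInX f U)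
    (heq : (Finset.univ.filter fun x : Fin m → F => MvPolynomial.eval x f = 0).card +
      (d - 1) * Fintype.card F ^ j =
      Fintype.card F ^ (j + 1) + (d - 1) * Fintype.card F ^ (m - 1))
    (K : Submodule F ((Fin m → F) ⧸ W)) :
    (Finset.univ.filter fun x : Fin m → F => W.mkQ x ∈ K ∧ MvPolynomial.eval x f = 0).card +
      (d - 1) * Fintype.card F ^ j =
      Fintype.card F ^ (j + 1) + (d - 1) * Fintype.card F ^ (Module.finrank F K + j) := by
  have hle : ∀ c ∈ (Finset.univ.filter
      (· ∈ (⊤ : Submodule F ((Fin m → F) ⧸ W)))).erase 0, _ ≤ _ := fun c hc =>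
    card_zeros_coset_le_of_maximal hf hdq hr hW hmax (Finset.ne_of_mem_erase hc)
  have h := card_zeros_eq_sum_cosets hr hW ⊤
  simp only [Submodule.mem_top, true_and] at h
  have hcard := card_erase_zero_add_one (⊤ : Submodule F ((Fin m → F) ⧸ W))
  rw [finrank_top] at hcard
  have hm := finrank_quotient_eq hr
  simp only [Submodule.mem_top] at hle hcard
  rw [h] at heq
  have hp : (d - 1) * Fintype.card F ^ (m - 1) =
      Fintype.card F ^ Module.finrank F ((Fin m → F) ⧸ W) * ((d - 1) * Fintype.card F ^ j) := by
    have : m - 1 = Module.finrank F ((Fin m → F) ⧸ W) + j := by omega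
    rw [this, pow_add]; ring
  rw [hp, ← hcard, add_mul, one_mul] at heq
  have hall := (Finset.sum_eq_sum_iff_of_le hle).1 (by
    rw [Finset.sum_const, smul_eq_mul]; omega)
  rw [card_zeros_eq_sum_cosets hr hW K, Finset.sum_congr rfl (fun c hc => hall c (by
    simpa using Finset.ne_of_mem_erase hc)), Finset.sum_const, smul_eq_mul, pow_add _ _ j,
    ← card_erase_zero_add_one K]
  ring

theorem card_projectivization_mul {V : Type*} [AddCommGroup V] [Module F V] [Fintype V]
    (P : V → Prop) (h0 : P 0) (hP : ∀ (c : F) (x : V), P x → P (c • x)) :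
    Nat.card {p : Projectivization F V // P p.rep} * (Fintype.card F - 1) + 1 =
      (Finset.univ.filter fun x : V => P x).card := by
  have hbij : Function.Bijective
      (fun z : {p : Projectivization F V // P p.rep} × Fˣ =>
        (⟨(z.2 : F) • z.1.1.rep, smul_ne_zero z.2.ne_zero z.1.1.rep_nonzero, hP _ _ z.1.2⟩ :
          {x : V // x ≠ 0 ∧ P x})) := by
    constructor
    · rintro ⟨⟨p, hp⟩, u⟩ ⟨⟨p₁, hp₁⟩, u₁⟩ h
      have h : (u : F) • p.rep = (u₁ : F) • p₁.rep := congrArg Subtype.val h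
      have hpp : p = p₁ := by
        rw [← p.mk_rep, ← p₁.mk_rep, Projectivization.mk_eq_mk_iff']
        refine ⟨(u : F)⁻¹ * u₁, ?_⟩
        rw [mul_smul, ← h, inv_smul_smul₀ u.ne_zero]
      subst hpp
      have := smul_left_injective F p.rep_nonzero h
      rw [Units.ext this]
    · rintro ⟨x, hx, hPx⟩
      obtain ⟨a, ha⟩ := Projectivization.exists_smul_eq_mk_rep F x hx
      refine ⟨⟨⟨Projectivization.mk F x hx, ?_⟩, a⁻¹⟩, ?_⟩
      · rw [← ha]; exact hP _ _ hPx
      · apply Subtype.ext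
        change (a⁻¹ : Fˣ) • (Projectivization.mk F x hx).rep = x
        rw [← ha, inv_smul_smul]
  have h := Nat.card_congr (Equiv.ofBijective _ hbij)
  rw [Nat.card_prod, Nat.card_eq_fintype_card (α := Fˣ), Fintype.card_units] at h
  rw [h, Nat.card_eq_fintype_card, Fintype.card_subtype,
    ← Finset.card_erase_add_one (s := Finset.univ.filter fun x : V => P x) (a := 0) (by simpa)]
  congr 2
  ext x
  simp

theorem exists_subInX_through {m d k : ℕ} {f : MvPolynomial (Fin m) F}
    (hf : f.IsHomogeneous d) (hd : 1 ≤ d) (hdq : d ≤ Fintype.card F)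
    (heq : (Finset.univ.filter fun x : Fin m → F => MvPolynomial.eval x f = 0).card +
      (d - 1) * Fintype.card F ^ k =
      Fintype.card F ^ (k + 1) + (d - 1) * Fintype.card F ^ (m - 1))
    {v : Fin m → F} (hv : v ≠ 0) (hvX : MvPolynomial.eval v f = 0) :
    ∀ j ≤ k, ∃ W : Submodule F (Fin m → F), v ∈ W ∧ Module.finrank F W = j + 1 ∧ SubInX f W := by
  intro j
  induction j with
  | zero =>
    refine fun _ => ⟨Submodule.span F {v}, Submodule.mem_span_singleton_self v,
      finrank_span_singleton hv, fun x hx => ?_⟩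
    obtain ⟨t, rfl⟩ := Submodule.mem_span_singleton.1 hx
    rw [eval_smul_eq hf, hvX, mul_zero]
  | succ j ih =>
    intro hj
    obtain ⟨W, hvW, hr, hW⟩ := ih (by omega)
    by_contra hno
    have h := card_zeros_add_le hf hdq hr hW fun ⟨U, hWU, hU, hUX⟩ => hno ⟨U, hWU hvW, hU, hUX⟩
    have hlt : Fintype.card F ^ j < Fintype.card F ^ k :=
      Nat.pow_lt_pow_right Fintype.one_lt_card (by omega)
    obtain ⟨e, rfl⟩ := Nat.exists_eq_add_of_le' hd
    obtain ⟨t, ht⟩ := Nat.exists_eq_add_of_le hdq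
    simp only [Nat.add_sub_cancel] at h heq
    rw [pow_succ (Fintype.card F) j] at h
    rw [pow_succ (Fintype.card F) k] at heq
    generalize Fintype.card F ^ j = a at *
    generalize Fintype.card F ^ k = b at *
    generalize Fintype.card F ^ (m - 1) = M at *
    rw [ht] at h heq
    generalize (e + 1 + t) = u at *
    nlinarith

theorem degree_le_card_of_card_zeros_eq {m d k : ℕ} {f : MvPolynomial (Fin m) F} (hkm : k + 1 < m)
    (hne : ∃ x : Fin m → F, MvPolynomial.eval x f ≠ 0)
    (heq : (Finset.univ.filter fun x : Fin m → F => MvPolynomial.eval x f = 0).card +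
      (d - 1) * Fintype.card F ^ k =
      Fintype.card F ^ (k + 1) + (d - 1) * Fintype.card F ^ (m - 1)) :
    d ≤ Fintype.card F := by
  by_contra! hlt
  obtain ⟨x, hx⟩ := hne
  have hcard : (Finset.univ.filter fun x : Fin m → F => MvPolynomial.eval x f = 0).card <
      Fintype.card F ^ m := by
    calc _ < (Finset.univ : Finset (Fin m → F)).card :=
          Finset.card_lt_card (Finset.filter_ssubset.2 ⟨x, Finset.mem_univ x, hx⟩)
      _ = _ := by simp
  have hm : Fintype.card F ^ m = Fintype.card F ^ (m - 1) * Fintype.card F := by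
    rw [← pow_succ]; congr 1; omega
  have hle : Fintype.card F ^ k ≤ Fintype.card F ^ (m - 1) :=
    Nat.pow_le_pow_right Fintype.card_pos (by omega)
  obtain ⟨s, rfl⟩ := Nat.exists_eq_add_of_lt hlt
  simp only [Nat.add_sub_cancel] at heq
  rw [hm] at hcard
  rw [pow_succ] at heq
  nlinarith [Nat.mul_le_mul_left s hle]

end PointCounts

theorem NP_mul_add_one {q : ℕ} (hq : 1 ≤ q) (N : ℕ) : NP q N * (q - 1) + 1 = q ^ (N + 1) := by
  obtain ⟨t, rfl⟩ := Nat.exists_eq_add_of_le hq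
  rw [NP, Nat.add_sub_cancel_left, Nat.add_comm 1 t]
  exact geom_sum_mul_add t (N + 1)

theorem Theta_mul_add {q : ℕ} (hq : 1 ≤ q) (d : ℕ) {n k : ℕ} (hk : k ≤ n) :
    Theta q d n k * (q - 1) + 1 + (d - 1) * q ^ k = q ^ (k + 1) + (d - 1) * q ^ (n + 1) := by
  have h1 := NP_mul_add_one hq (n - k)
  have h2 := NP_mul_add_one hq k
  have h3 : q ^ (n + 1) = q ^ k * q ^ (n - k + 1) := by
    rw [← pow_add]; congr 1; omega
  rw [h3, ← h1, ← h2, Theta]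
  ring

theorem stmt8 {F : Type*} [Field F] [Fintype F] {n d k : ℕ}
    (hn : 1 ≤ n) (hd : 2 ≤ d) (hk1 : 0 < k) (hkn : k ≤ n - 1)
    (f : MvPolynomial (Fin (n + 2)) F) (hf0 : f ≠ 0) (hsq : Squarefree f)
    (hhom : f.IsHomogeneous d) (hthas : ThasEq f k)
    (heq : numPoints f = Theta (Fintype.card F) d n k)
    (v : Fin (n + 2) → F) (hv : v ≠ 0) (hvX : MvPolynomial.eval v f = 0)
    (hns : ∃ i, MvPolynomial.eval v (MvPolynomial.pderiv i f) ≠ 0) :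
    Nat.card {p : Projectivization F (Fin (n + 2) → F) //
        MvPolynomial.eval p.rep f = 0 ∧
        ∑ i, MvPolynomial.eval v (MvPolynomial.pderiv i f) * p.rep i = 0}
      = Theta (Fintype.card F) d (n - 1) k := by
  classical
  have hq : 1 ≤ Fintype.card F := Fintype.card_pos
  have hZ := card_projectivization_mul (F := F) (fun x : Fin (n + 2) → F =>
    MvPolynomial.eval x f = 0) (by simpa using (eval_smul_eq hhom 0 v).trans (by simp [hvX]))
    fun c x hx => by rw [eval_smul_eq hhom, hx, mul_zero]
  have heqZ := Theta_mul_add hq d (show k ≤ n by omega)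
  rw [← heq, numPoints, hZ] at heqZ
  have hne : ∃ x : Fin (n + 2) → F, MvPolynomial.eval x f ≠ 0 := by
    by_contra! h
    obtain ⟨W, hr, hW⟩ := hthas.1
    obtain ⟨y, hy⟩ : ∃ y, y ∉ W := by
      by_contra! hy
      rw [(Submodule.eq_top_iff'.2 hy), finrank_top, Module.finrank_fin_fun] at hr
      omega
    exact hthas.2 ⟨W ⊔ Submodule.span F {y}, by
      rw [Submodule.finrank_sup_span_singleton hy, hr], fun x _ => h x⟩
  have hdq : d ≤ Fintype.card F :=
    degree_le_card_of_card_zeros_eq (m := n + 2) (by omega) hne heqZ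
  obtain ⟨W, hvW, hr, hW⟩ := exists_subInX_through (m := n + 2) hhom (by omega) hdq heqZ hv hvX k
    le_rfl
  have hmax : ¬ ∃ U : Submodule F (Fin (n + 2) → F), W ≤ U ∧ Module.finrank F U = k + 2 ∧
      SubInX f U := fun ⟨U, _, hU⟩ => hthas.2 ⟨U, hU⟩
  let τ : Module.Dual F (Fin (n + 2) → F) :=
    ∑ i, MvPolynomial.eval v (MvPolynomial.pderiv i f) • LinearMap.proj i
  have hτ : ∀ x, τ x = ∑ i, MvPolynomial.eval v (MvPolynomial.pderiv i f) * x i := fun x => by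
    simp [τ]
  have hWτ : W ≤ LinearMap.ker τ := fun w hw => by
    rw [LinearMap.mem_ker, hτ, tangent_of_line hhom hdq hW hvW hw]
  let σ : Module.Dual F ((Fin (n + 2) → F) ⧸ W) := W.liftQ τ hWτ
  have hσ : σ ≠ 0 := by
    obtain ⟨i, hi⟩ := hns
    intro h
    apply hi
    have : σ (W.mkQ (Pi.single i 1)) = 0 := by rw [h, LinearMap.zero_apply]
    rw [Submodule.mkQ_apply, Submodule.liftQ_apply, hτ] at this
    simpa [Pi.single_apply] using this
  have hcount := card_zeros_comap_add_eq hhom hdq hr hW hmax heqZ (LinearMap.ker σ)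
  have hker := Module.Dual.finrank_ker_add_one_of_ne_zero hσ
  have hquot := finrank_quotient_eq hr
  rw [show Module.finrank F (LinearMap.ker σ) + k = n - 1 + 1 by omega,
    ← Theta_mul_add hq d hkn] at hcount
  have hT := card_projectivization_mul (F := F) (fun x : Fin (n + 2) → F =>
    MvPolynomial.eval x f = 0 ∧
      ∑ i, MvPolynomial.eval v (MvPolynomial.pderiv i f) * x i = 0)
    ⟨by simpa using (eval_smul_eq hhom 0 v).trans (by simp [hvX]), by simp⟩
    fun c x hx => ⟨by rw [eval_smul_eq hhom, hx.1, mul_zero], by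
      rw [← hτ, map_smul, hτ, hx.2, smul_zero]⟩
  have hsets : (Finset.univ.filter fun x : Fin (n + 2) → F =>
      W.mkQ x ∈ LinearMap.ker σ ∧ MvPolynomial.eval x f = 0) =
      Finset.univ.filter fun x : Fin (n + 2) → F => MvPolynomial.eval x f = 0 ∧
        ∑ i, MvPolynomial.eval v (MvPolynomial.pderiv i f) * x i = 0 := by
    ext x
    simp only [Finset.mem_filter, Finset.mem_univ, true_and, LinearMap.mem_ker]
    rw [Submodule.mkQ_apply, Submodule.liftQ_apply, hτ, and_comm]
  have hfin := Nat.add_right_cancel hcount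
  have hfinal := hT.trans (Eq.trans (by convert (congrArg Finset.card hsets).symm) hfin)
  have hq2 : 0 < Fintype.card F - 1 := by
    have := Fintype.one_lt_card (α := F)
    omega
  exact (Nat.eq_of_mul_eq_mul_right hq2 (Nat.add_right_cancel hfinal))
end

section
/- Let X be a hypersurface of degree d and dimension n in P^{n+1} over F_q with 0 < k_X ≤ n, suppose N_q(X) = Θ_{n,k_X}^{d,q}, and let L be an F_q-linear subspace of dimension k_X contained in X. Then for every F_q-linear subspace L' of P^{n+1} of dimension k_X + 1 containing L, the set X(F_q) ∩ L' is the union of the F_q-points of d pairwise distinct F_q-linear subspaces of dimension k_X contained in X. -/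
section PolynomialFunctions

universe u v

variable {F : Type u} [Field F]

/-- The affine functions on a vector space; the functions of degree at most `e` form the `e`-th
power of this submodule of the algebra of all functions. -/
def affineFunctions (F : Type u) [Field F] (V : Type v) [AddCommGroup V] [Module F V] :
    Submodule F (V → F) where
  carrier := {h | ∃ (l : V →ₗ[F] F) (c : F), ∀ v, h v = l v + c}
  add_mem' := by
    rintro a b ⟨l, c, h⟩ ⟨l', c', h'⟩
    exact ⟨l + l', c + c', fun v => by simp [h, h']; ring⟩
  zero_mem' := ⟨0, 0, by simp⟩
  smul_mem' := by
    rintro a b ⟨l, c, h⟩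
    exact ⟨a • l, a * c, fun v => by simp [h]; ring⟩

variable {V W : Type v} [AddCommGroup V] [Module F V] [AddCommGroup W] [Module F W]

theorem comp_affine_mem_pow (T : W →ₗ[F] V) (b : V) {e : ℕ} :
    ∀ {h : V → F}, h ∈ affineFunctions F V ^ e →
      (fun w => h (T w + b)) ∈ affineFunctions F W ^ e := by
  induction e with
  | zero =>
    intro h hh
    rw [pow_zero, Submodule.mem_one] at hh ⊢
    obtain ⟨c, rfl⟩ := hh
    exact ⟨c, rfl⟩
  | succ e ih =>
    intro h hh
    rw [pow_succ] at hh ⊢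
    induction hh using Submodule.mul_induction_on' with
    | mem_mul_mem x hx y hy =>
      obtain ⟨l, c, hl⟩ := hy
      exact Submodule.mul_mem_mul (ih hx)
        (show (fun w => y (T w + b)) ∈ affineFunctions F W from
          ⟨l ∘ₗ T, l b + c, fun w => by simp [hl, add_assoc]⟩)
    | add x _ y _ hx hy => exact Submodule.add_mem _ hx hy

theorem exists_sub_comp_eq_mul (l : V →ₗ[F] F) (c : F) (u : V) {e : ℕ} :
    ∀ {h : V → F}, h ∈ affineFunctions F V ^ (e + 1) →
      ∃ g ∈ affineFunctions F V ^ e, ∀ v, h v - h (v - (l v - c) • u) = (l v - c) * g v := by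
  induction e with
  | zero =>
    intro h hh
    rw [zero_add, pow_one] at hh
    obtain ⟨m, a, hm⟩ := hh
    refine ⟨fun _ => m u, ?_, fun v => by simp [hm]⟩
    rw [pow_zero, Submodule.mem_one]
    exact ⟨m u, rfl⟩
  | succ e ih =>
    intro h hh
    rw [pow_succ] at hh
    induction hh using Submodule.mul_induction_on' with
    | mem_mul_mem x hx y hy =>
      obtain ⟨g, hg, hgx⟩ := ih hx
      obtain ⟨m, a, hm⟩ := hy
      refine ⟨m u • x + g * fun v => y (v - (l v - c) • u), ?_, fun v => ?_⟩
      · refine Submodule.add_mem _ (Submodule.smul_mem _ _ hx) ?_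
        rw [pow_succ]
        refine Submodule.mul_mem_mul hg ⟨m - m u • l, c * m u + a, fun v => ?_⟩
        simp [hm]
        ring
      · have hv := hgx v
        simp only [Pi.mul_apply, Pi.add_apply, Pi.smul_apply, smul_eq_mul, hm, map_sub, map_smul]
        linear_combination (m v - (l v - c) * m u + a) * hv
    | add x _ y _ hx hy =>
      obtain ⟨g, hg, h1⟩ := hx
      obtain ⟨g', hg', h2⟩ := hy
      refine ⟨g + g', Submodule.add_mem _ hg hg', fun v => ?_⟩
      simp only [Pi.add_apply]
      linear_combination h1 v + h2 v

theorem exists_apply_eq_one {l : V →ₗ[F] F} (hl : l ≠ 0) : ∃ u, l u = 1 :=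
  LinearMap.surjective hl 1

theorem exists_eq_mul_of_vanish {l : V →ₗ[F] F} (hl : l ≠ 0) (c : F) {e : ℕ} {h : V → F}
    (hh : h ∈ affineFunctions F V ^ (e + 1)) (hz : ∀ v, l v = c → h v = 0) :
    ∃ g ∈ affineFunctions F V ^ e, ∀ v, h v = (l v - c) * g v := by
  obtain ⟨u, hu⟩ := exists_apply_eq_one hl
  obtain ⟨g, hg, hgv⟩ := exists_sub_comp_eq_mul l c u hh
  refine ⟨g, hg, fun v => ?_⟩
  rw [← hgv, hz (v - (l v - c) • u) (by simp [hu]), sub_zero]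

/-- Two affine hyperplanes without common point are parallel. -/
theorem exists_eq_mul_of_disjoint {l l' : V →ₗ[F] F} (hl : l ≠ 0) (hl' : l' ≠ 0) {c c' : F}
    (h : ∀ v, l v = c → l' v ≠ c') : ∃ a : F, a ≠ 0 ∧ ∀ v, l' v = a * l v := by
  obtain ⟨u, hu⟩ := exists_apply_eq_one hl
  have key : ∀ w, l w = 0 → l' w = 0 := by
    intro w hw
    by_contra hne
    refine h (c • u + ((c' - l' (c • u)) / l' w) • w) (by simp [hu, hw]) ?_
    simp only [map_add, map_smul, smul_eq_mul]
    field_simp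
    ring
  have hv : ∀ v, l' v = l' u * l v := by
    intro v
    have := key (v - l v • u) (by simp [hu])
    simp only [map_sub, map_smul, smul_eq_mul] at this
    linear_combination this
  refine ⟨l' u, fun h0 => hl' (LinearMap.ext fun v => ?_), hv⟩
  simp [hv v, h0]

theorem ncard_eq_sum_fibers {α β : Type*} [Finite α] [Fintype β] (S : Set α) (p : α → β) :
    S.ncard = ∑ c, {v | v ∈ S ∧ p v = c}.ncard := by
  classical
  have := Fintype.ofFinite α
  simp only [Set.ncard_eq_toFinset_card']
  rw [Finset.card_eq_sum_card_fiberwise (f := p) (t := Finset.univ) (by simp)]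
  refine Finset.sum_congr rfl fun c _ => congrArg _ ?_
  ext v
  simp

theorem ncard_slice_eq (l : V →ₗ[F] F) {u : V} (hu : l u = 1) (c : F) (P : V → Prop) :
    {v | P v ∧ l v = c}.ncard = {w : LinearMap.ker l | P (w + c • u)}.ncard := by
  rw [← Set.ncard_image_of_injective (f := fun w : LinearMap.ker l => (w : V) + c • u) _
    (fun a b hab => Subtype.ext (add_right_cancel hab))]
  congr 1
  ext v
  constructor
  · rintro ⟨h1, h2⟩
    exact ⟨⟨v - c • u, by simp [hu, h2]⟩, by simpa using h1, by simp⟩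
  · rintro ⟨w, hw, rfl⟩
    exact ⟨hw, by simp [hu]⟩

theorem card_mul_ncard_fiber [Fintype F] [Finite V] {l : V →ₗ[F] F} (hl : l ≠ 0) (c : F) :
    Fintype.card F * {v | l v = c}.ncard = Nat.card V := by
  obtain ⟨u, hu⟩ := exists_apply_eq_one hl
  have h : ∀ c, {v | l v = c}.ncard = Nat.card (LinearMap.ker l) := by
    intro c
    simpa using ncard_slice_eq l hu c fun _ => True
  have := ncard_eq_sum_fibers (Set.univ : Set V) l
  simp only [Set.mem_univ, true_and, h, Finset.sum_const, Finset.card_univ, smul_eq_mul,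
    Set.ncard_univ] at this
  rw [h, this]

theorem finrank_ker_add_one [FiniteDimensional F V] {l : V →ₗ[F] F} (hl : l ≠ 0) :
    Module.finrank F (LinearMap.ker l) + 1 = Module.finrank F V := by
  have h1 := l.finrank_range_add_finrank_ker
  rw [LinearMap.range_eq_top.2 (LinearMap.surjective hl), finrank_top, Module.finrank_self] at h1
  omega

theorem exists_dual_ne_zero {m : ℕ} (hm : Module.finrank F V = m + 1) :
    ∃ l : V →ₗ[F] F, l ≠ 0 := by
  have : Nontrivial V := Module.nontrivial_of_finrank_pos (R := F) (by omega)
  exact exists_ne (0 : Module.Dual F V)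

theorem card_mul_card_ker [Fintype F] [Finite V] {l : V →ₗ[F] F} (hl : l ≠ 0) :
    Fintype.card F * Nat.card (LinearMap.ker l) = Nat.card V :=
  card_mul_ncard_fiber hl 0

theorem zeros_eq_empty_of_mem_pow_zero {h : V → F} (hh : h ∈ affineFunctions F V ^ 0)
    (hne : h ≠ 0) : {v | h v = 0} = ∅ := by
  rw [pow_zero, Submodule.mem_one] at hh
  obtain ⟨c, rfl⟩ := hh
  ext v
  simp only [Set.mem_ofPred_eq, Set.mem_empty_iff_false, iff_false]
  intro h0
  exact hne (funext fun _ => h0)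

theorem ncard_union_hyperplane [Finite V] {l : V →ₗ[F] F} {c : F} {h g : V → F}
    (hg : ∀ v, h v = (l v - c) * g v) :
    {v | h v = 0}.ncard = {v | l v = c}.ncard + {v | g v = 0 ∧ l v ≠ c}.ncard := by
  rw [← Set.ncard_union_eq]
  · congr 1
    ext v
    simp only [hg, mul_eq_zero, sub_eq_zero, Set.mem_ofPred_eq, Set.mem_union]
    tauto
  · rw [Set.disjoint_left]
    exact fun v h1 h2 => h2.2 h1

/-- A nonzero function of degree at most `e` has at most `e * q ^ (dim V - 1)` zeros. -/
theorem card_mul_ncard_zeros_le [Fintype F] (m : ℕ) :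
    ∀ (V : Type v) [AddCommGroup V] [Module F V] [Finite V], Module.finrank F V = m →
    ∀ (e : ℕ) (h : V → F), h ∈ affineFunctions F V ^ e → h ≠ 0 →
      Fintype.card F * {v | h v = 0}.ncard ≤ e * Nat.card V := by
  induction m with
  | zero =>
    intro V _ _ _ hV e h _ hne
    have : Subsingleton V := Module.finrank_zero_iff.1 hV
    have : {v | h v = 0} = ∅ := by
      ext v
      simp only [Set.mem_ofPred_eq, Set.mem_empty_iff_false, iff_false]
      exact fun h0 => hne (funext fun w => by rw [Subsingleton.elim w v, h0, Pi.zero_apply])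
    simp [this]
  | succ m ihm =>
    intro V _ _ _ hV e
    induction e with
    | zero =>
      intro h hh hne
      simp [zeros_eq_empty_of_mem_pow_zero hh hne]
    | succ e ihe =>
      intro h hh hne
      by_cases hyp : ∃ (l : V →ₗ[F] F) (c : F), l ≠ 0 ∧ ∀ v, l v = c → h v = 0
      · obtain ⟨l, c, hl, hz⟩ := hyp
        obtain ⟨g, hg, hgv⟩ := exists_eq_mul_of_vanish hl c hh hz
        have hg0 : g ≠ 0 := by
          rintro rfl
          exact hne (funext fun v => by simp [hgv])
        have h1 := ihe g hg hg0
        have h2 := card_mul_ncard_fiber hl c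
        have h3 : {v | g v = 0 ∧ l v ≠ c}.ncard ≤ {v | g v = 0}.ncard :=
          Set.ncard_le_ncard (fun v hv => hv.1)
        rw [ncard_union_hyperplane hgv, mul_add, h2]
        have h4 := Nat.mul_le_mul_left (Fintype.card F) h3
        linarith
      · push Not at hyp
        obtain ⟨l, hl⟩ := exists_dual_ne_zero hV
        obtain ⟨u, hu⟩ := exists_apply_eq_one hl
        have hk := finrank_ker_add_one hl
        rw [ncard_eq_sum_fibers _ l, Finset.mul_sum]
        calc _ ≤ ∑ _c : F, (e + 1) * Nat.card (LinearMap.ker l) := by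
              refine Finset.sum_le_sum fun c _ => ?_
              have := ncard_slice_eq l hu c fun v => h v = 0
              simp only [Set.mem_ofPred_eq]
              rw [this]
              refine ihm _ (by omega) (e + 1) _ (comp_affine_mem_pow (Submodule.subtype _) _ hh) ?_
              intro h0
              obtain ⟨v, hv, hv'⟩ := hyp l c hl
              apply hv'
              have := congrFun h0 ⟨v - c • u, by simp [hu, hv]⟩
              simpa using this
          _ = _ := by
              rw [Finset.sum_const, Finset.card_univ, smul_eq_mul, ← card_mul_card_ker hl]
              ring

theorem ncard_slice_of_extremal [Fintype F] [Finite V] {e : ℕ} {h : V → F}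
    (hh : h ∈ affineFunctions F V ^ e)
    (heq : Fintype.card F * {v | h v = 0}.ncard = e * Nat.card V)
    {l : V →ₗ[F] F} (hl : l ≠ 0)
    (hyp : ∀ c, ∃ v, l v = c ∧ h v ≠ 0) (c : F) :
    Fintype.card F * {v | h v = 0 ∧ l v = c}.ncard = e * Nat.card (LinearMap.ker l) := by
  obtain ⟨u, hu⟩ := exists_apply_eq_one hl
  have hle : ∀ c ∈ (Finset.univ : Finset F),
      Fintype.card F * {v | h v = 0 ∧ l v = c}.ncard ≤ e * Nat.card (LinearMap.ker l) := by
    intro c _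
    rw [ncard_slice_eq l hu c fun v => h v = 0]
    refine card_mul_ncard_zeros_le _ _ rfl e _
      (comp_affine_mem_pow (Submodule.subtype _) _ hh) ?_
    intro h0
    obtain ⟨v, hv, hv'⟩ := hyp c
    apply hv'
    have := congrFun h0 ⟨v - c • u, by simp [hu, hv]⟩
    simpa using this
  refine (Finset.sum_eq_sum_iff_of_le hle).1 ?_ c (Finset.mem_univ c)
  rw [← Finset.mul_sum]
  have h1 := ncard_eq_sum_fibers {v | h v = 0} l
  simp only [Set.mem_ofPred_eq] at h1
  rw [← h1, heq, Finset.sum_const, Finset.card_univ, smul_eq_mul, ← card_mul_card_ker hl]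
  ring

theorem sum_ncard_pencil [Fintype F] [Finite V] (Z : Set V) (l l₂ : V →ₗ[F] F) (s : F) :
    ∑ t : F, {v | v ∈ Z ∧ (t • l + l₂) v = s}.ncard + {v | v ∈ Z ∧ l v = 0}.ncard =
      Z.ncard + Fintype.card F * {v | v ∈ Z ∧ l v = 0 ∧ l₂ v = s}.ncard := by
  classical
  have hsplit : ∀ t : F, {v | v ∈ Z ∧ (t • l + l₂) v = s}.ncard =
      {v | (v ∈ Z ∧ l v ≠ 0) ∧ (s - l₂ v) / l v = t}.ncard +
        {v | v ∈ Z ∧ l v = 0 ∧ l₂ v = s}.ncard := by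
    intro t
    rw [← Set.ncard_union_eq]
    · congr 1
      ext v
      simp only [Set.mem_ofPred_eq, Set.mem_union, LinearMap.add_apply, LinearMap.smul_apply,
        smul_eq_mul]
      by_cases h0 : l v = 0
      · simp [h0]
      · rw [div_eq_iff h0]
        simp only [h0, ne_eq, not_false_eq_true, and_true, false_and, and_false, or_false]
        refine and_congr_right fun _ => ⟨fun h => ?_, fun h => ?_⟩ <;> linear_combination -h
    · rw [Set.disjoint_left]
      exact fun v h1 h2 => h1.1.2 h2.2.1
  have h1 := ncard_eq_sum_fibers {v | v ∈ Z ∧ l v ≠ 0} fun v => (s - l₂ v) / l v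
  simp only [Set.mem_ofPred_eq] at h1
  have h2 : Z.ncard = {v | v ∈ Z ∧ l v ≠ 0}.ncard + {v | v ∈ Z ∧ l v = 0}.ncard := by
    rw [← Set.ncard_union_eq]
    · congr 1
      ext v
      simp only [Set.mem_ofPred_eq, Set.mem_union]
      tauto
    · rw [Set.disjoint_left]
      exact fun v h1 h2 => h1.2 h2.2
  simp only [hsplit]
  rw [Finset.sum_add_distrib, ← h1, h2, Finset.sum_const, Finset.card_univ, smul_eq_mul]
  ring

theorem hyperplane_subset_of_ncard [Finite V] {l : V →ₗ[F] F} {h : V → F}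
    (hc : {v | h v = 0 ∧ l v = 0}.ncard = Nat.card (LinearMap.ker l)) :
    ∀ v, l v = 0 → h v = 0 := by
  have hsub : {v | h v = 0 ∧ l v = 0} ⊆ {v | l v = 0} := fun v hv => hv.2
  have := Set.eq_of_subset_of_ncard_le hsub (by rw [hc]; exact le_rfl)
  intro v hv
  exact (this.ge hv).1

theorem exists_hyperplane_of_slice [Fintype F] [Finite V] {e : ℕ} {h : V → F}
    (hh : h ∈ affineFunctions F V ^ e)
    (heq : Fintype.card F * {v | h v = 0}.ncard = e * Nat.card V)
    {l : V →ₗ[F] F} (hl : l ≠ 0) {μ : LinearMap.ker l →ₗ[F] F} (hμ : μ ≠ 0) (s : F)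
    (hs : ∀ w, μ w = s → h w = 0) :
    ∃ (l : V →ₗ[F] F) (c : F), l ≠ 0 ∧ ∀ v, l v = c → h v = 0 := by
  by_contra! hyp
  obtain ⟨l₂, hl₂⟩ := LinearMap.exists_extend μ
  have hl₂' : ∀ w : LinearMap.ker l, l₂ w = μ w := fun w => by rw [← hl₂]; rfl
  have hq : 0 < Fintype.card F := Fintype.card_pos
  have hne : ∀ t : F, t • l + l₂ ≠ 0 := by
    intro t h0
    refine hμ (LinearMap.ext fun w => ?_)
    have h1 := LinearMap.congr_fun h0 (w : V)
    have h2 : l w = 0 := w.2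
    simpa [h2, hl₂'] using h1
  have hslice : ∀ (l' : V →ₗ[F] F), l' ≠ 0 → ∀ c, {v | h v = 0 ∧ l' v = c}.ncard =
      {v | h v = 0 ∧ l v = 0}.ncard := by
    intro l' hl' c
    have h1 := ncard_slice_of_extremal hh heq hl' (fun c => hyp l' c hl') c
    have h2 := ncard_slice_of_extremal hh heq hl (fun c => hyp l c hl) 0
    have h3 : Nat.card (LinearMap.ker l') = Nat.card (LinearMap.ker l) :=
      Nat.eq_of_mul_eq_mul_left hq ((card_mul_card_ker hl').trans (card_mul_card_ker hl).symm)
    rw [h3] at h1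
    exact Nat.eq_of_mul_eq_mul_left hq (h1.trans h2.symm)
  have hpencil := sum_ncard_pencil {v | h v = 0} l l₂ s
  have hZ := ncard_eq_sum_fibers {v | h v = 0} l
  have hA : {v | h v = 0 ∧ l v = 0 ∧ l₂ v = s}.ncard = {w | μ w = s}.ncard := by
    rw [← Set.ncard_image_of_injective _ (Submodule.subtype_injective (LinearMap.ker l))]
    congr 1
    ext v
    constructor
    · rintro ⟨_, h2, h3⟩
      exact ⟨⟨v, h2⟩, by simpa [← hl₂'] using h3, rfl⟩
    · rintro ⟨w, hw, rfl⟩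
      exact ⟨hs w hw, w.2, (hl₂' w).trans hw⟩
  simp only [Set.mem_ofPred_eq] at hpencil hZ
  simp only [hslice _ (hne _), hslice l hl, Finset.sum_const, Finset.card_univ, smul_eq_mul, hA,
    card_mul_ncard_fiber hμ s] at hpencil hZ
  obtain ⟨v, hv, hv'⟩ := hyp l 0 hl
  exact hv' (hyperplane_subset_of_ncard (by omega) v hv)

theorem exists_parallel_of_hyperplane [Fintype F] [Finite V] {e : ℕ}
    (ih : ∀ g : V → F, g ∈ affineFunctions F V ^ e → g ≠ 0 →
      Fintype.card F * {v | g v = 0}.ncard = e * Nat.card V →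
      ∃ (l : V →ₗ[F] F) (S : Finset F), l ≠ 0 ∧ S.card = e ∧ ∀ v, g v = 0 ↔ l v ∈ S)
    {h : V → F} (hh : h ∈ affineFunctions F V ^ (e + 1)) (hne : h ≠ 0)
    (heq : Fintype.card F * {v | h v = 0}.ncard = (e + 1) * Nat.card V)
    {l : V →ₗ[F] F} (hl : l ≠ 0) {c : F} (hz : ∀ v, l v = c → h v = 0) :
    ∃ (l : V →ₗ[F] F) (S : Finset F), l ≠ 0 ∧ S.card = e + 1 ∧ ∀ v, h v = 0 ↔ l v ∈ S := by
  classical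
  have hq : 0 < Fintype.card F := Fintype.card_pos
  obtain ⟨g, hg, hgv⟩ := exists_eq_mul_of_vanish hl c hh hz
  have hg0 : g ≠ 0 := by
    rintro rfl
    exact hne (funext fun v => by simp [hgv])
  have hbound := card_mul_ncard_zeros_le _ V rfl e g hg hg0
  rw [ncard_union_hyperplane hgv, mul_add, card_mul_ncard_fiber hl c] at heq
  have hsub : {v | g v = 0 ∧ l v ≠ c} ⊆ {v | g v = 0} := fun v hv => hv.1
  have hle := Set.ncard_le_ncard hsub
  have hmul : Fintype.card F * {v | g v = 0 ∧ l v ≠ c}.ncard = e * Nat.card V := by linarith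
  have hge : {v | g v = 0}.ncard ≤ {v | g v = 0 ∧ l v ≠ c}.ncard :=
    Nat.le_of_mul_le_mul_left (hbound.trans hmul.ge) hq
  have hdisj : ∀ v, l v = c → g v ≠ 0 := by
    intro v hv h0
    exact ((Set.eq_of_subset_of_ncard_le hsub hge).ge h0).2 hv
  rw [le_antisymm hle hge] at hmul
  obtain ⟨l', S, hl', hS, hgS⟩ := ih g hg hg0 hmul
  obtain rfl | ⟨c', hc'⟩ := S.eq_empty_or_nonempty
  · refine ⟨l, {c}, hl, by simpa using hS.symm, fun v => ?_⟩
    have := (hgS v).not.2 (by simp)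
    simp [hgv, this, sub_eq_zero]
  · obtain ⟨a, ha, hla⟩ := exists_eq_mul_of_disjoint hl hl' (c := c) (c' := c')
      fun v hv hv' => hdisj v hv ((hgS v).2 (hv' ▸ hc'))
    obtain ⟨u, hu⟩ := exists_apply_eq_one hl
    have hac : a * c ∉ S := fun hmem =>
      hdisj (c • u) (by simp [hu]) ((hgS _).2 (by simpa [hla, hu] using hmem))
    refine ⟨l', insert (a * c) S, hl', by rw [Finset.card_insert_of_notMem hac, hS],
      fun v => ?_⟩
    rw [hgv, mul_eq_zero, hgS, Finset.mem_insert, hla, mul_right_inj' ha, sub_eq_zero]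

/-- The zero set of a function of degree at most `e` with the maximal number of zeros is a union of
`e` parallel hyperplanes. -/
theorem exists_parallel_of_extremal [Fintype F] (m : ℕ) :
    ∀ (V : Type v) [AddCommGroup V] [Module F V] [Finite V], Module.finrank F V = m + 1 →
    ∀ (e : ℕ) (h : V → F), h ∈ affineFunctions F V ^ e → h ≠ 0 →
      Fintype.card F * {v | h v = 0}.ncard = e * Nat.card V →
      ∃ (l : V →ₗ[F] F) (S : Finset F), l ≠ 0 ∧ S.card = e ∧ ∀ v, h v = 0 ↔ l v ∈ S := by
  have hq : 0 < Fintype.card F := Fintype.card_pos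
  induction m with
  | zero =>
    intro V _ _ _ hV e
    obtain ⟨l, hl⟩ := exists_dual_ne_zero hV
    induction e with
    | zero =>
      intro h hh hne _
      have := zeros_eq_empty_of_mem_pow_zero hh hne
      exact ⟨l, ∅, hl, rfl, fun v => by simpa using Set.ext_iff.1 this v⟩
    | succ e ihe =>
      intro h hh hne heq
      have hpos : 0 < {v | h v = 0}.ncard := by
        refine Nat.pos_of_mul_pos_left (a := Fintype.card F) ?_
        rw [heq]
        exact Nat.mul_pos e.succ_pos Nat.card_pos
      obtain ⟨p, hp⟩ := Set.nonempty_of_ncard_ne_zero hpos.ne'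
      refine exists_parallel_of_hyperplane ihe hh hne heq hl (c := l p) fun v hv => ?_
      have hk : LinearMap.ker l = ⊥ := by
        have := finrank_ker_add_one hl
        exact Submodule.finrank_eq_zero.1 (by omega)
      rwa [LinearMap.ker_eq_bot.1 hk hv]
  | succ m ihm =>
    intro V _ _ _ hV e
    obtain ⟨l, hl⟩ := exists_dual_ne_zero hV
    induction e with
    | zero =>
      intro h hh hne _
      have := zeros_eq_empty_of_mem_pow_zero hh hne
      exact ⟨l, ∅, hl, rfl, fun v => by simpa using Set.ext_iff.1 this v⟩
    | succ e ihe =>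
      intro h hh hne heq
      suffices ∃ (l : V →ₗ[F] F) (c : F), l ≠ 0 ∧ ∀ v, l v = c → h v = 0 by
        obtain ⟨l, c, hl, hz⟩ := this
        exact exists_parallel_of_hyperplane ihe hh hne heq hl hz
      by_contra hyp
      have hyp' := hyp
      push Not at hyp'
      have hslice := ncard_slice_of_extremal hh heq hl (fun c => hyp' l c hl) 0
      have h0 : {v | h v = 0 ∧ l v = 0}.ncard = {w : LinearMap.ker l | h w = 0}.ncard := by
        obtain ⟨u, hu⟩ := exists_apply_eq_one hl
        simpa using ncard_slice_eq l hu 0 fun v => h v = 0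
      rw [h0] at hslice
      have hk := finrank_ker_add_one hl
      obtain ⟨μ, S, hμ, hS, hμS⟩ := ihm (LinearMap.ker l) (by omega) (e + 1) (fun w => h w)
        (by simpa using comp_affine_mem_pow (LinearMap.ker l).subtype 0 hh)
        (fun hz => by
          obtain ⟨v, hv, hv'⟩ := hyp' l 0 hl
          exact hv' (congrFun hz ⟨v, hv⟩)) hslice
      obtain ⟨s, hs⟩ := Finset.card_pos.1 (hS.trans_gt e.succ_pos)
      exact hyp (exists_hyperplane_of_slice hh heq hl hμ s fun w hw => (hμS w).2 (hw ▸ hs))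

/-- A homogeneous polynomial of degree `d` defines a function of degree at most `d`. -/
theorem eval_mem_affineFunctions_pow {m d : ℕ} {f : MvPolynomial (Fin m) F}
    (hf : f.IsHomogeneous d) :
    (fun v => MvPolynomial.eval v f) ∈ affineFunctions F (Fin m → F) ^ d := by
  have hrw : (fun v => MvPolynomial.eval v f) =
      ∑ s ∈ f.support, f.coeff s • ∏ i, (fun v : Fin m → F => v i) ^ s i := by
    funext v
    simp [MvPolynomial.eval_eq']
  rw [hrw]
  refine Submodule.sum_mem _ fun s hs => Submodule.smul_mem _ _ ?_
  have hdeg : ∑ i, s i = d := by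
    have := hf (MvPolynomial.mem_support_iff.1 hs)
    simpa [Finsupp.weight_apply, Finsupp.sum_fintype] using this
  rw [← hdeg]
  refine Finset.induction_on (Finset.univ : Finset (Fin m)) (by simp) fun i t hi ih => ?_
  rw [Finset.prod_insert hi, Finset.sum_insert hi, pow_add]
  exact Submodule.mul_mem_mul
    (Submodule.pow_mem_pow _
      (show (fun v : Fin m → F => v i) ∈ affineFunctions F (Fin m → F) from
        ⟨LinearMap.proj i, 0, by simp⟩) _) ih

theorem eval_smul_of_isHomogeneous {m d : ℕ} {f : MvPolynomial (Fin m) F}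
    (hf : f.IsHomogeneous d) (c : F) (v : Fin m → F) :
    MvPolynomial.eval (c • v) f = c ^ d * MvPolynomial.eval v f := by
  rw [MvPolynomial.eval_eq', MvPolynomial.eval_eq', Finset.mul_sum]
  refine Finset.sum_congr rfl fun s hs => ?_
  have hdeg : ∑ i, s i = d := by
    have := hf (MvPolynomial.mem_support_iff.1 hs)
    simpa [Finsupp.weight_apply, Finsupp.sum_fintype] using this
  simp only [Pi.smul_apply, smul_eq_mul, mul_pow, Finset.prod_mul_distrib,
    Finset.prod_pow_eq_pow_sum, hdeg]
  ring

theorem eval_smul_eq_zero_iff {m d : ℕ} {f : MvPolynomial (Fin m) F}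
    (hf : f.IsHomogeneous d) {c : F} (hc : c ≠ 0) (v : Fin m → F) :
    MvPolynomial.eval (c • v) f = 0 ↔ MvPolynomial.eval v f = 0 := by
  simp [eval_smul_of_isHomogeneous hf, hc]

theorem ncard_zeros_eq_numPoints [Fintype F] {m d : ℕ} (hd : d ≠ 0) {f : MvPolynomial (Fin m) F}
    (hf : f.IsHomogeneous d) :
    {v | MvPolynomial.eval v f = 0}.ncard = numPoints f * (Fintype.card F - 1) + 1 := by
  let g : {p : Projectivization F (Fin m → F) // MvPolynomial.eval p.rep f = 0} × Fˣ →
    (Fin m → F) := fun x => (x.2 : F) • x.1.1.rep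
  have hg0 : ∀ x, g x ≠ 0 := fun x => smul_ne_zero x.2.ne_zero x.1.1.rep_nonzero
  have hg : Function.Injective g := by
    rintro ⟨⟨p, hp⟩, a⟩ ⟨⟨p', hp'⟩, a'⟩ h
    have h' : (a : F) • p.rep = (a' : F) • p'.rep := h
    have hpp : p = p' := by
      rw [← p.mk_rep, ← p'.mk_rep, Projectivization.mk_eq_mk_iff']
      refine ⟨(a : F)⁻¹ * a', ?_⟩
      rw [mul_smul, ← h', inv_smul_smul₀ a.ne_zero]
    subst hpp
    have haa : a = a' := Units.ext (smul_left_injective F p.rep_nonzero h')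
    rw [haa]
  have hz : {v | MvPolynomial.eval v f = 0} = insert 0 (Set.range g) := by
    ext v
    constructor
    · intro hv
      by_cases h0 : v = 0
      · exact Or.inl h0
      · right
        obtain ⟨a, ha⟩ := Projectivization.exists_smul_eq_mk_rep F v h0
        have hv' : MvPolynomial.eval (Projectivization.mk F v h0).rep f = 0 := by
          rw [← ha]
          exact (eval_smul_eq_zero_iff hf a.ne_zero v).2 hv
        refine ⟨⟨⟨_, hv'⟩, a⁻¹⟩, ?_⟩
        change ((a⁻¹ : Fˣ) : F) • (Projectivization.mk F v h0).rep = v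
        rw [← ha]
        exact inv_smul_smul a v
    · rintro (rfl | ⟨x, rfl⟩)
      · have := eval_smul_of_isHomogeneous hf 0 0
        simpa [hd] using this
      · exact (eval_smul_eq_zero_iff hf x.2.ne_zero _).2 x.1.2
  rw [hz, Set.ncard_insert_of_notMem (by rintro ⟨x, hx⟩; exact hg0 x hx),
    ← Nat.card_coe_set_eq, Nat.card_range_of_injective hg, Nat.card_prod, numPoints]
  rw [Nat.card_units, Nat.card_eq_fintype_card (α := F)]

theorem ncard_eq_sum_cosets [Finite V] {W U : Submodule F V} (hWU : IsCompl W U) [Fintype U]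
    (P : V → Prop) :
    {v | P v}.ncard = ∑ u : U, {w : W | P (w + u)}.ncard := by
  have h1 : {v | P v}.ncard = {x : W × U | P (x.1 + x.2)}.ncard := by
    rw [← Set.ncard_image_of_injective _ (Submodule.prodEquivOfIsCompl W U hWU).injective]
    congr 1
    ext v
    constructor
    · intro hv
      obtain ⟨x, rfl⟩ := (Submodule.prodEquivOfIsCompl W U hWU).surjective v
      refine ⟨x, ?_, rfl⟩
      rwa [Set.mem_ofPred_eq, Submodule.coe_prodEquivOfIsCompl'] at hv
    · rintro ⟨x, hx, rfl⟩
      rwa [Set.mem_ofPred_eq, Submodule.coe_prodEquivOfIsCompl']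
  rw [h1, ncard_eq_sum_fibers _ Prod.snd]
  refine Finset.sum_congr rfl fun u _ => ?_
  rw [← Set.ncard_image_of_injective {w : W | P (w + u)} (Prod.mk_left_injective u)]
  refine congrArg Set.ncard (Set.ext fun x => ?_)
  constructor
  · obtain ⟨w, u'⟩ := x
    rintro ⟨h, rfl⟩
    exact ⟨w, h, rfl⟩
  · rintro ⟨w, h, rfl⟩
    exact ⟨h, rfl⟩

/-- The parametrization of the span of `W` and `u`. -/
def joinMap (W : Submodule F V) (u : V) : W × F →ₗ[F] V :=
  W.subtype.coprod (LinearMap.toSpanSingleton F V u)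

theorem joinMap_apply (W : Submodule F V) (u : V) (x : W × F) :
    joinMap W u x = x.1 + x.2 • u := by
  simp [joinMap]

theorem joinMap_injective {W : Submodule F V} {u : V} (hu : u ∉ W) :
    Function.Injective (joinMap W u) := by
  rw [← LinearMap.ker_eq_bot, LinearMap.ker_eq_bot']
  rintro ⟨w, t⟩ h
  rw [joinMap_apply] at h
  have ht : t = 0 := by
    by_contra ht
    refine hu ((Submodule.smul_mem_iff W ht).1 ?_)
    rw [eq_neg_of_add_eq_zero_right h]
    exact W.neg_mem w.2
  subst ht
  simpa using h

theorem finrank_prod_field [FiniteDimensional F V] (W : Submodule F V) :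
    Module.finrank F (W × F) = Module.finrank F W + 1 := by
  rw [Module.finrank_prod, Module.finrank_self]

/-- The functional on `W × F` cutting out `W × 0` for `none`, and the points `(w, t)` with
`l w = s * t` for `some s`. -/
def pencilForm {W : Type*} [AddCommGroup W] [Module F W] (l : W →ₗ[F] F) :
    Option F → (W × F →ₗ[F] F)
  | none => LinearMap.snd F W F
  | some s => l ∘ₗ LinearMap.fst F W F - s • LinearMap.snd F W F

theorem pencilForm_none_apply {W : Type*} [AddCommGroup W] [Module F W] (l : W →ₗ[F] F)
    (x : W × F) : pencilForm l none x = x.2 := rfl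

theorem pencilForm_some_apply {W : Type*} [AddCommGroup W] [Module F W] (l : W →ₗ[F] F) (s : F)
    (x : W × F) : pencilForm l (some s) x = l x.1 - s * x.2 := rfl

theorem pencilForm_ne_zero {W : Type*} [AddCommGroup W] [Module F W] {l : W →ₗ[F] F} (hl : l ≠ 0)
    (i : Option F) : pencilForm l i ≠ 0 := by
  intro h
  cases i with
  | none => simpa [pencilForm_none_apply] using LinearMap.congr_fun h (0, 1)
  | some s =>
    refine hl (LinearMap.ext fun w => ?_)
    simpa [pencilForm_some_apply] using LinearMap.congr_fun h (w, 0)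

theorem ker_pencilForm_injective {W : Type*} [AddCommGroup W] [Module F W] {l : W →ₗ[F] F}
    (hl : l ≠ 0) : Function.Injective fun i => LinearMap.ker (pencilForm l i) := by
  obtain ⟨u, hu⟩ := LinearMap.surjective hl 1
  have hmem : ∀ s, (s • u, 1) ∈ LinearMap.ker (pencilForm l (some s)) := by
    intro s
    simp [pencilForm_some_apply, hu]
  intro i j hij
  change LinearMap.ker (pencilForm l i) = LinearMap.ker (pencilForm l j) at hij
  rcases i with - | s <;> rcases j with - | t
  · rfl
  · have := hij.ge (hmem t)
    simp [pencilForm_none_apply] at this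
  · have := hij.le (hmem s)
    simp [pencilForm_none_apply] at this
  · have := hij.le (hmem s)
    rw [LinearMap.mem_ker, pencilForm_some_apply] at this
    simp only [map_smul, hu, smul_eq_mul, mul_one] at this
    rw [sub_eq_zero.1 this]

variable {m d : ℕ} {f : MvPolynomial (Fin m) F}

theorem eval_coset_mem_pow (hf : f.IsHomogeneous (d + 1)) {W : Submodule F (Fin m → F)}
    (hW : SubInX f W) (u : Fin m → F) :
    (fun w : W => MvPolynomial.eval ((w : Fin m → F) + u) f) ∈ affineFunctions F W ^ d := by
  have hF : (fun x : W × F => MvPolynomial.eval (joinMap W u x) f) ∈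
      affineFunctions F (W × F) ^ (d + 1) := by
    simpa using comp_affine_mem_pow (joinMap W u) 0 (eval_mem_affineFunctions_pow hf)
  obtain ⟨g, hg, hgv⟩ := exists_eq_mul_of_vanish (l := LinearMap.snd F W F)
    (fun h => one_ne_zero (LinearMap.congr_fun h (0, 1))) 0 hF
    (by
      rintro ⟨w, t⟩ (rfl : t = 0)
      simpa [joinMap_apply] using hW w w.2)
  convert comp_affine_mem_pow (LinearMap.inl F W F) (0, 1) hg using 2 with w
  have := hgv (w, 1)
  simpa [joinMap_apply] using this

theorem eval_add_smul_eq_zero_iff (hf : f.IsHomogeneous d) (w u : Fin m → F) {t : F} (ht : t ≠ 0) :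
    MvPolynomial.eval (w + t • u) f = 0 ↔ MvPolynomial.eval (t⁻¹ • w + u) f = 0 := by
  rw [← eval_smul_eq_zero_iff hf ht (t⁻¹ • w + u), smul_add, smul_inv_smul₀ ht]

theorem eval_coset_ne_zero {k : ℕ} (hf : f.IsHomogeneous d) (hthas : ThasEq f k)
    {W : Submodule F (Fin m → F)} (hW : Module.finrank F W = k + 1) (hWX : SubInX f W)
    {u : Fin m → F} (hu : u ∉ W) :
    (fun w : W => MvPolynomial.eval ((w : Fin m → F) + u) f) ≠ 0 := by
  intro h0
  refine hthas.2 ⟨LinearMap.range (joinMap W u), ?_, ?_⟩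
  · rw [LinearMap.finrank_range_of_inj (joinMap_injective hu), finrank_prod_field, hW]
  · rintro _ ⟨⟨w, t⟩, rfl⟩
    rw [joinMap_apply]
    by_cases ht : t = 0
    · subst ht
      simpa using hWX w w.2
    · exact (eval_add_smul_eq_zero_iff hf _ _ ht).2 (congrFun h0 (t⁻¹ • w))

theorem NP_mul_pred_add_one [Fintype F] (N : ℕ) :
    NP (Fintype.card F) N * (Fintype.card F - 1) + 1 = Fintype.card F ^ (N + 1) := by
  obtain ⟨q, hq⟩ : ∃ q, Fintype.card F = q + 1 := ⟨_, (Nat.sub_add_cancel Fintype.card_pos).symm⟩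
  rw [hq, NP, Nat.add_sub_cancel]
  exact geom_sum_mul_add q (N + 1)

/-- Every coset of `W` outside `W` contains the maximal number of points of an extremal
hypersurface. -/
theorem card_mul_ncard_coset_eq [Fintype F] {n k : ℕ} (hkn : k ≤ n)
    {f : MvPolynomial (Fin (n + 2)) F} (hf : f.IsHomogeneous (d + 1)) (hthas : ThasEq f k)
    (heq : numPoints f = Theta (Fintype.card F) (d + 1) n k)
    {W U : Submodule F (Fin (n + 2) → F)} (hW : Module.finrank F W = k + 1) (hWX : SubInX f W)
    (hWU : IsCompl W U) {u : Fin (n + 2) → F} (huU : u ∈ U) (hu0 : u ≠ 0) :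
    Fintype.card F * {w : W | MvPolynomial.eval ((w : Fin (n + 2) → F) + u) f = 0}.ncard =
      d * Nat.card W := by
  classical
  have := Fintype.ofFinite U
  have hle : ∀ u ∈ (Finset.univ : Finset U).erase 0,
      Fintype.card F *
        {w : W | MvPolynomial.eval ((w : Fin (n + 2) → F) + (u : Fin (n + 2) → F)) f = 0}.ncard ≤
        d * Nat.card W := by
    intro u hu
    have hu' : (u : Fin (n + 2) → F) ∉ W := fun h =>
      Finset.ne_of_mem_erase hu (Subtype.ext (Submodule.disjoint_def.1 hWU.disjoint _ h u.2))
    exact card_mul_ncard_zeros_le _ W rfl d _ (eval_coset_mem_pow hf hWX _)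
      (eval_coset_ne_zero hf hthas hW hWX hu')
  refine (Finset.sum_eq_sum_iff_of_le hle).1 ?_ ⟨u, huU⟩ (by simpa using hu0)
  have hcount := ncard_zeros_eq_numPoints d.succ_ne_zero hf
  rw [ncard_eq_sum_cosets hWU fun v => MvPolynomial.eval v f = 0,
    ← Finset.add_sum_erase _ _ (Finset.mem_univ (0 : U)), heq, Theta, Nat.add_sub_cancel] at hcount
  have hzero :
      {w : W | MvPolynomial.eval ((w : Fin (n + 2) → F) + ((0 : U) : Fin (n + 2) → F)) f = 0}.ncard =
      Nat.card W := by
    rw [← Set.ncard_univ]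
    congr 1
    ext w
    simpa using hWX w w.2
  have hcW : Nat.card W = Fintype.card F ^ (k + 1) := by
    rw [Module.natCard_eq_pow_finrank (K := F), hW, Nat.card_eq_fintype_card]
  have hcU : Fintype.card U = Fintype.card F ^ (n - k + 1) := by
    have h1 := Submodule.finrank_add_eq_of_isCompl hWU
    rw [Module.finrank_fin_fun, hW] at h1
    rw [← Nat.card_eq_fintype_card, Module.natCard_eq_pow_finrank (K := F),
      Nat.card_eq_fintype_card]
    congr 1
    omega
  have hk := NP_mul_pred_add_one (F := F) k
  have hnk := NP_mul_pred_add_one (F := F) (n - k)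
  rw [hzero, hcW] at hcount
  rw [← Finset.mul_sum, Finset.sum_const, Finset.card_erase_of_mem (Finset.mem_univ _),
    Finset.card_univ, hcU, hcW, ← hnk, Nat.add_sub_cancel, smul_eq_mul, pow_succ]
  rw [← hk] at hcount
  generalize ∑ u ∈ (Finset.univ : Finset U).erase 0,
    {w : W | MvPolynomial.eval ((w : Fin (n + 2) → F) + (u : Fin (n + 2) → F)) f = 0}.ncard = s at hcount ⊢
  have hs : s = d * Fintype.card F ^ k * NP (Fintype.card F) (n - k) * (Fintype.card F - 1) := by
    linarith
  rw [hs]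
  ring

theorem eval_joinMap_eq_zero_iff {e : ℕ} (hf : f.IsHomogeneous e) {W : Submodule F (Fin m → F)}
    (hWX : SubInX f W) {u : Fin m → F} {l : W →ₗ[F] F} {S : Finset F}
    (hS : ∀ w : W, MvPolynomial.eval ((w : Fin m → F) + u) f = 0 ↔ l w ∈ S) (x : W × F) :
    MvPolynomial.eval (joinMap W u x) f = 0 ↔
      ∃ i ∈ Finset.insertNone S, x ∈ LinearMap.ker (pencilForm l i) := by
  obtain ⟨w, t⟩ := x
  rw [joinMap_apply]
  by_cases ht : t = 0
  · subst ht
    refine iff_of_true (by simpa using hWX w w.2) ⟨none, by simp, ?_⟩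
    rw [LinearMap.mem_ker, pencilForm_none_apply]
  · rw [eval_add_smul_eq_zero_iff hf _ _ ht]
    refine (hS (t⁻¹ • w)).trans ?_
    rw [map_smul, smul_eq_mul]
    constructor
    · intro h
      refine ⟨some (t⁻¹ * l w), by simpa using h, ?_⟩
      rw [LinearMap.mem_ker, pencilForm_some_apply]
      field_simp
      ring
    · rintro ⟨i | s, hi, hx⟩
      · exact absurd hx ht
      · rw [LinearMap.mem_ker, pencilForm_some_apply, sub_eq_zero] at hx
        simp only at hx
        rw [hx, mul_comm s, inv_mul_cancel_left₀ ht]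
        simpa using hi

end PolynomialFunctions

theorem stmt9 {F : Type*} [Field F] [Fintype F] {n d k : ℕ}
    (hn : 1 ≤ n) (hd : 2 ≤ d) (hk1 : 0 < k) (hkn : k ≤ n)
    (f : MvPolynomial (Fin (n + 2)) F) (hf0 : f ≠ 0) (hsq : Squarefree f)
    (hhom : f.IsHomogeneous d) (hthas : ThasEq f k)
    (heq : numPoints f = Theta (Fintype.card F) d n k)
    (W : Submodule F (Fin (n + 2) → F))
    (hW : Module.finrank F W = k + 1) (hWX : SubInX f W) :
    ∀ W' : Submodule F (Fin (n + 2) → F), W ≤ W' → Module.finrank F W' = k + 2 →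
      ∃ Ws : Fin d → Submodule F (Fin (n + 2) → F),
        Function.Injective Ws ∧
        (∀ i, Module.finrank F (Ws i) = k + 1) ∧
        (∀ i, SubInX f (Ws i)) ∧
        {v : Fin (n + 2) → F | v ∈ W' ∧ MvPolynomial.eval v f = 0}
          = ⋃ i, (Ws i : Set (Fin (n + 2) → F)) := by
  intro W' hWW' hW'
  obtain ⟨e, rfl⟩ : ∃ e, d = e + 1 := ⟨d - 1, by omega⟩
  obtain ⟨U, hWU⟩ := Submodule.exists_isCompl W
  obtain ⟨u, huU, huW', hu0⟩ : ∃ u ∈ U, u ∈ W' ∧ u ≠ 0 := by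
    have hlt : W < W' := lt_of_le_of_ne hWW' (by rintro rfl; omega)
    obtain ⟨v, hv', hv⟩ := SetLike.exists_of_lt hlt
    obtain ⟨w, hw, u, hu, rfl⟩ :=
      Submodule.mem_sup.1 (hWU.sup_eq_top.ge (Submodule.mem_top (x := v)))
    refine ⟨u, hu, by simpa using W'.sub_mem hv' (hWW' hw), ?_⟩
    rintro rfl
    exact hv (by simpa using hw)
  have huW : u ∉ W := fun h => hu0 (Submodule.disjoint_def.1 hWU.disjoint _ h huU)
  obtain ⟨l, S, hl, hSc, hS⟩ := exists_parallel_of_extremal k W hW e _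
    (eval_coset_mem_pow hhom hWX u) (eval_coset_ne_zero hhom hthas hW hWX huW)
    (card_mul_ncard_coset_eq hkn hhom hthas heq hW hWX hWU huU hu0)
  have hinj := joinMap_injective huW
  have hrange : LinearMap.range (joinMap W u) = W' := by
    refine Submodule.eq_of_le_of_finrank_eq ?_ ?_
    · rintro _ ⟨x, rfl⟩
      rw [joinMap_apply]
      exact W'.add_mem (hWW' x.1.2) (W'.smul_mem _ huW')
    · rw [LinearMap.finrank_range_of_inj hinj, finrank_prod_field, hW, hW']
  have key := eval_joinMap_eq_zero_iff hhom hWX hS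
  let idx : Fin (e + 1) ≃ Finset.insertNone S :=
    (Finset.equivFinOfCardEq (by rw [Finset.card_insertNone, hSc])).symm
  refine ⟨fun i => (LinearMap.ker (pencilForm l (idx i))).map (joinMap W u), ?_, fun i => ?_,
    fun i => ?_, ?_⟩
  · exact (Submodule.map_injective_of_injective hinj).comp
      ((ker_pencilForm_injective hl).comp (Subtype.val_injective.comp idx.injective))
  · rw [← (Submodule.equivMapOfInjective _ hinj _).finrank_eq]
    have := finrank_ker_add_one (pencilForm_ne_zero hl (idx i))
    rw [finrank_prod_field, hW] at this
    omega
  · rintro _ ⟨x, hx, rfl⟩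
    exact (key x).2 ⟨idx i, (idx i).2, hx⟩
  · ext v
    simp only [Set.mem_ofPred_eq, Set.mem_iUnion, SetLike.mem_coe, Submodule.mem_map, ← hrange,
      LinearMap.mem_range]
    constructor
    · rintro ⟨⟨x, rfl⟩, hx⟩
      obtain ⟨i, hi, hxi⟩ := (key x).1 hx
      exact ⟨idx.symm ⟨i, hi⟩, x, by rwa [Equiv.apply_symm_apply], rfl⟩
    · rintro ⟨i, x, hx, rfl⟩
      exact ⟨⟨x, rfl⟩, (key x).2 ⟨idx i, (idx i).2, hx⟩⟩
end

section
/- Let X be a hypersurface of degree d and dimension n in P^{n+1} over F_q with k_X = n. Then N_q(X) = (d−1)·q^n + N_q(P^n) if and only if there exist pairwise non-proportional linear forms l_1,…,l_d ∈ F_q[X_0,…,X_{n+1}] and c ∈ F_q^× such that f = c·l_1⋯l_d and the F_q-linear span of {l_1,…,l_d} in the space of linear forms has dimension at most 2 (i.e., X is a union of d hyperplanes over F_q containing a common F_q-linear subspace of codimension 2 in P^{n+1}). -/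
open MvPolynomial in
/-- The homogeneous linear polynomial representing a linear functional. -/
noncomputable def linForm {F : Type*} [Field F] {m : ℕ} (a : (Fin m → F) →ₗ[F] F) :
    MvPolynomial (Fin m) F :=
  ∑ i, C (a (Pi.single i 1)) * X i

namespace LinForm

open MvPolynomial

variable {F : Type*} [Field F] {m : ℕ}

theorem eval_linForm (a : (Fin m → F) →ₗ[F] F) (x : Fin m → F) :
    eval x (linForm a) = a x := by
  conv_rhs => rw [pi_eq_sum_univ' x, map_sum]
  simp [linForm, map_sum, mul_comm]

theorem isHomogeneous_linForm (a : (Fin m → F) →ₗ[F] F) : (linForm a).IsHomogeneous 1 :=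
  IsHomogeneous.sum _ _ _ fun i _ => isHomogeneous_C_mul_X _ i

theorem linForm_ne_zero {a : (Fin m → F) →ₗ[F] F} (ha : a ≠ 0) : linForm a ≠ 0 := by
  rintro h
  apply ha
  ext x
  simp [← eval_linForm, h]

theorem irreducible_of_isHomogeneous_one {l : MvPolynomial (Fin m) F} (hl : l.IsHomogeneous 1)
    (h0 : l ≠ 0) : Irreducible l := by
  refine irreducible_of_totalDegree_eq_one (hl.totalDegree h0) fun x hx => ?_
  obtain ⟨i, hi⟩ := exists_coeff_ne_zero h0
  refine isUnit_iff_ne_zero.mpr ?_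
  rintro rfl
  exact hi (zero_dvd_iff.mp (hx i))

theorem exists_eq_linForm {l : MvPolynomial (Fin m) F} (hl : l.IsHomogeneous 1) :
    ∃ a : (Fin m → F) →ₗ[F] F, l = linForm a := by
  have hmem : l ∈ homogeneousSubmodule (Fin m) F 1 := hl
  rw [homogeneousSubmodule_one_eq_span_X, Submodule.mem_span_range_iff_exists_fun] at hmem
  obtain ⟨c, rfl⟩ := hmem
  refine ⟨∑ i, c i • LinearMap.proj i, ?_⟩
  refine Finset.sum_congr rfl fun i _ => ?_
  simp [smul_eq_C_mul, Pi.single_apply]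

theorem linForm_linear :
    ∃ L : ((Fin m → F) →ₗ[F] F) →ₗ[F] MvPolynomial (Fin m) F, ∀ a, L a = linForm a :=
  ⟨{ toFun := linForm
     map_add' := fun a b => by simp [linForm, add_mul, Finset.sum_add_distrib]
     map_smul' := fun c a => by simp [linForm, Finset.smul_sum, smul_eq_C_mul, mul_assoc] },
    fun _ => rfl⟩

theorem exists_homogeneous_factor {l f : MvPolynomial (Fin m) F} {e : ℕ}
    (hl : l.IsHomogeneous 1) (hf : f.IsHomogeneous (e + 1)) (h : l ∣ f) :
    ∃ g : MvPolynomial (Fin m) F, g.IsHomogeneous e ∧ f = l * g := by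
  obtain ⟨g, rfl⟩ := h
  refine ⟨homogeneousComponent e g, homogeneousComponent_isHomogeneous _ _, ?_⟩
  have key (i : ℕ) : homogeneousComponent (e + 1) (l * homogeneousComponent i g) =
      if i = e then l * homogeneousComponent i g else 0 := by
    have := hl.mul (homogeneousComponent_isHomogeneous i g)
    rw [homogeneousComponent_of_mem this]
    congr 1
    simp only [eq_iff_iff]
    omega
  conv_lhs => rw [← homogeneousComponent_eq_self hf, ← sum_homogeneousComponent g]
  rw [Finset.mul_sum, map_sum, Finset.sum_congr rfl fun i _ => key i, Finset.sum_ite_eq']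
  split_ifs with he
  · rfl
  · rw [homogeneousComponent_eq_zero e g (by simp at he; omega), mul_zero]

theorem linForm_dvd [Fintype F] {a : (Fin m → F) →ₗ[F] F} (ha : a ≠ 0)
    {f : MvPolynomial (Fin m) F} {d : ℕ} (hf : f.IsHomogeneous d) (hd : d ≤ Fintype.card F)
    (h : ∀ x, a x = 0 → eval x f = 0) : linForm a ∣ f := by
  obtain ⟨u, hu⟩ : ∃ u, a u = 1 := by
    obtain ⟨u, hu⟩ := DFunLike.ne_iff.mp ha
    exact ⟨(a u)⁻¹ • u, by simpa using inv_mul_cancel₀ hu⟩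
  set g : Fin m → MvPolynomial (Fin m) F := fun i => X i - C (u i) * linForm a
  have hg0 : aeval g f = 0 := by
    refine IsHomogeneous.eq_zero_of_forall_eval_eq_zero_of_le_card (n := 1 * d)
      (hf.aeval g fun i => (isHomogeneous_X _ i).sub ((isHomogeneous_linForm a).C_mul _)) ?_ ?_
    · intro x
      have : eval x (aeval g f) = eval (x - a x • u) f := by
        rw [aeval_def, eval_eval₂, eval₂_eq', eval_eq']
        simp [g, eval_linForm, mul_comm]
      rw [this]
      exact h _ (by simp [hu])
    · simpa using hd
  rw [← Ideal.mem_span_singleton, ← Ideal.Quotient.eq_zero_iff_mem]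
  have : ∀ p : MvPolynomial (Fin m) F, Ideal.Quotient.mkₐ F (Ideal.span {linForm a}) (aeval g p) =
      Ideal.Quotient.mkₐ F (Ideal.span {linForm a}) p := by
    intro p
    rw [← AlgHom.comp_apply]
    congr 1
    apply MvPolynomial.algHom_ext
    intro i
    simp only [AlgHom.comp_apply, aeval_X, Ideal.Quotient.mkₐ_eq_mk, g]
    rw [Ideal.Quotient.mk_eq_mk_iff_sub_mem, Ideal.mem_span_singleton]
    exact ⟨-C (u i), by ring⟩
  have h2 := this f
  rw [hg0, map_zero] at h2
  exact h2.symm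

end LinForm

namespace Pencil

open MvPolynomial LinForm

variable {F : Type*} [Field F] {m : ℕ}

theorem eval_smul_of_isHomogeneous {f : MvPolynomial (Fin m) F} {d : ℕ} (hf : f.IsHomogeneous d)
    (c : F) (x : Fin m → F) : eval (c • x) f = c ^ d * eval x f := by
  rw [eval_eq', eval_eq', Finset.mul_sum]
  refine Finset.sum_congr rfl fun s hs => ?_
  have hdeg : ∑ i, s i = d := by
    rw [hf.degree_eq_sum_deg_support hs, ← Finsupp.degree_apply, Finsupp.degree_eq_sum]
  simp only [Pi.smul_apply, smul_eq_mul, mul_pow, Finset.prod_mul_distrib,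
    Finset.prod_pow_eq_pow_sum, hdeg]
  ring

/-- The polynomial `g (x + T v)` in `T`, with coefficients polynomials in `x`. -/
noncomputable def linePoly (v : Fin m → F) (g : MvPolynomial (Fin m) F) :
    Polynomial (MvPolynomial (Fin m) F) :=
  finSuccEquiv F m (aeval (fun i => X i.succ + C (v i) * X 0) g)

theorem eval_map_linePoly (v : Fin m → F) (g : MvPolynomial (Fin m) F) (x : Fin m → F) (t : F) :
    ((linePoly v g).map (eval x)).eval t = eval (x + t • v) g := by
  rw [linePoly, ← eval_eq_eval_mv_eval', aeval_def, eval_eval₂, eval₂_eq', eval_eq']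
  simp [mul_comm]

theorem isHomogeneous_aeval_translate {g : MvPolynomial (Fin m) F} {e : ℕ} (hg : g.IsHomogeneous e)
    (v : Fin m → F) :
    (aeval (fun i => (X i.succ + C (v i) * X 0 : MvPolynomial (Fin (m + 1)) F)) g).IsHomogeneous
      e := by
  simpa using hg.aeval (n := 1) _ fun i =>
    (isHomogeneous_X F i.succ).add ((isHomogeneous_X F (0 : Fin (m + 1))).C_mul (v i))

theorem isHomogeneous_coeff_linePoly {g : MvPolynomial (Fin m) F} {e : ℕ} (hg : g.IsHomogeneous e)
    (v : Fin m → F) {i j : ℕ} (h : i + j = e) : ((linePoly v g).coeff i).IsHomogeneous j :=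
  (isHomogeneous_aeval_translate hg v).finSuccEquiv_coeff_isHomogeneous i j h

theorem natDegree_linePoly_le {g : MvPolynomial (Fin m) F} {e : ℕ} (hg : g.IsHomogeneous e)
    (v : Fin m → F) : (linePoly v g).natDegree ≤ e := by
  rw [linePoly, natDegree_finSuccEquiv]
  exact (degreeOf_le_totalDegree _ _).trans (isHomogeneous_aeval_translate hg v).totalDegree_le

theorem coeff_linePoly {g : MvPolynomial (Fin m) F} {e : ℕ} (hg : g.IsHomogeneous e)
    (v : Fin m → F) : (linePoly v g).coeff e = C (eval v g) := by
  have h0 := isHomogeneous_coeff_linePoly hg v (add_zero e)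
  rw [← totalDegree_zero_iff_isHomogeneous, totalDegree_eq_zero_iff_eq_C] at h0
  have h1 := eval_map_linePoly v g 0 1
  rw [Polynomial.eval_eq_sum_range' (n := e + 1) (by
    have := natDegree_linePoly_le hg v
    exact Nat.lt_succ_of_le (Polynomial.natDegree_map_le.trans this)),
    Finset.sum_eq_single_of_mem e (by simp)] at h1
  · rw [Polynomial.coeff_map, h0, eval_C, one_pow, mul_one, zero_add, one_smul] at h1
    rw [h0, h1]
  · intro i hi hie
    have hi' : i < e + 1 := Finset.mem_range.mp hi
    have h2 := isHomogeneous_coeff_linePoly hg v (i := i) (j := e - i) (by omega)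
    have h3 := eval_smul_of_isHomogeneous h2 0 0
    rw [zero_pow (by omega), zero_mul, smul_zero] at h3
    rw [Polynomial.coeff_map, h3, zero_mul]

theorem natDegree_map_linePoly {g : MvPolynomial (Fin m) F} {e : ℕ} (hg : g.IsHomogeneous e)
    {v : Fin m → F} (hv : eval v g ≠ 0) (x : Fin m → F) :
    ((linePoly v g).map (eval x)).natDegree = e := by
  refine Polynomial.natDegree_eq_of_le_of_coeff_ne_zero
    (Polynomial.natDegree_map_le.trans (natDegree_linePoly_le hg v)) ?_
  rw [Polynomial.coeff_map, coeff_linePoly hg]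
  simpa using hv

open Polynomial in
theorem exists_remainder {G : (MvPolynomial (Fin m) F)[X]} {e : ℕ} (he : 1 ≤ e) {c : F} (hc : c ≠ 0)
    (hdeg : G.natDegree ≤ e) (hlc : G.coeff e = MvPolynomial.C c)
    (hG : ∀ i j, i + j = e → (G.coeff i).IsHomogeneous j) (n : ℕ) :
    ∃ r : (MvPolynomial (Fin m) F)[X], (∀ j, e ≤ j → r.coeff j = 0) ∧
      (∀ j, n < j → r.coeff j = 0) ∧ (∀ i j, i + j = n → (r.coeff i).IsHomogeneous j) ∧
      G ∣ Polynomial.X ^ n - r := by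
  have hG0 : ∀ j, e < j → G.coeff j = 0 := fun j hj =>
    coeff_eq_zero_of_natDegree_lt (by omega)
  induction n with
  | zero =>
    refine ⟨1, fun j hj => ?_, fun j hj => ?_, fun i j hij => ?_, by simp⟩
    · rw [Polynomial.coeff_one, if_neg (by omega)]
    · rw [Polynomial.coeff_one, if_neg (by omega)]
    · obtain ⟨rfl, rfl⟩ : i = 0 ∧ j = 0 := by omega
      simpa using isHomogeneous_one _ _
  | succ n ih =>
    obtain ⟨r, h1, h2, h3, h4⟩ := ih
    refine ⟨Polynomial.X * r - Polynomial.C (MvPolynomial.C c⁻¹ * r.coeff (e - 1)) * G,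
      fun j hj => ?_, fun j hj => ?_, fun i j hij => ?_, ?_⟩
    · obtain ⟨j, rfl⟩ : ∃ k, j = k + 1 := ⟨j - 1, by omega⟩
      rw [Polynomial.coeff_sub, Polynomial.coeff_X_mul, Polynomial.coeff_C_mul]
      rcases hj.eq_or_lt with h | h
      · subst h
        rw [hlc, mul_right_comm, ← MvPolynomial.C_mul, inv_mul_cancel₀ hc]
        simp
      · rw [h1 _ (by omega), hG0 _ h]
        simp
    · obtain ⟨j, rfl⟩ : ∃ k, j = k + 1 := ⟨j - 1, by omega⟩
      rw [Polynomial.coeff_sub, Polynomial.coeff_X_mul, Polynomial.coeff_C_mul, h2 _ (by omega)]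
      rcases lt_or_ge e (j + 1) with h | h
      · simp [hG0 _ h]
      · simp [h2 (e - 1) (by omega)]
    · rw [Polynomial.coeff_sub, Polynomial.coeff_C_mul]
      refine IsHomogeneous.sub ?_ ?_
      · rcases i with _ | i
        · simpa using isHomogeneous_zero _ _ _
        · rw [Polynomial.coeff_X_mul]
          exact h3 _ _ (by omega)
      · rcases lt_or_ge n (e - 1) with h | h
        · simpa [h2 _ h] using isHomogeneous_zero _ _ _
        · rcases lt_or_ge e i with h' | h'
          · simpa [hG0 _ h'] using isHomogeneous_zero _ _ _
          · have := ((h3 (e - 1) (n - (e - 1)) (by omega)).C_mul c⁻¹).mul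
              (hG i (e - i) (by omega))
            rwa [show n - (e - 1) + (e - i) = j by omega] at this
    · have : Polynomial.X ^ (n + 1) -
          (Polynomial.X * r - Polynomial.C (MvPolynomial.C c⁻¹ * r.coeff (e - 1)) * G) =
          Polynomial.X * (Polynomial.X ^ n - r) +
            Polynomial.C (MvPolynomial.C c⁻¹ * r.coeff (e - 1)) * G := by ring
      rw [this]
      exact dvd_add (h4.mul_left _) (Dvd.intro_left _ rfl)

variable [Fintype F]

theorem sub_C_pow_card (ρ : F) : (Polynomial.X - Polynomial.C ρ) ^ Fintype.card F =
    Polynomial.X ^ Fintype.card F - Polynomial.C ρ := by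
  obtain ⟨p, hp⟩ := CharP.exists F
  obtain ⟨k, hpp, hk⟩ := FiniteField.card F p
  have := Fact.mk hpp
  rw [hk, sub_pow_char_pow, ← Polynomial.C_pow, ← hk, FiniteField.pow_card]

/-- If `g` has the maximal number `e` of zeros on every line in the direction `v` off the
hyperplane `a = 0`, it has exactly one zero on every such line in that hyperplane. -/
theorem existsUnique_zero {g : MvPolynomial (Fin m) F} {e : ℕ} (hg : g.IsHomogeneous e)
    (he : 1 ≤ e) {a : (Fin m → F) →ₗ[F] F} (ha : a ≠ 0) {v : Fin m → F} (hv : eval v g ≠ 0)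
    (hline : ∀ x, a x ≠ 0 → Nat.card {t : F // eval (x + t • v) g = 0} = e)
    {w : Fin m → F} (hw : a w = 0) : ∃ ρ : F, ∀ t, eval (w + t • v) g = 0 ↔ t = ρ := by
  classical
  set q := Fintype.card F with hq
  have hq1 : 1 < q := Fintype.one_lt_card
  obtain ⟨rq, hq1', hq2, hq3, k, hk⟩ := exists_remainder he hv (natDegree_linePoly_le hg v)
    (coeff_linePoly hg v) (fun i j h => isHomogeneous_coeff_linePoly hg v h) q
  obtain ⟨r1, h11, h12, h13, k1, hk1⟩ := exists_remainder he hv (natDegree_linePoly_le hg v)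
    (coeff_linePoly hg v) (fun i j h => isHomogeneous_coeff_linePoly hg v h) 1
  obtain ⟨L, hL⟩ : ∃ L, L = linForm a ^ (q - 1) := ⟨_, rfl⟩
  have hLhom : L.IsHomogeneous (q - 1) := by
    simpa [hL] using (isHomogeneous_linForm a).pow (q - 1)
  have hLeval (x : Fin m → F) : eval x L = a x ^ (q - 1) := by
    rw [hL, map_pow, eval_linForm]
  set r := rq - Polynomial.C L * r1 with hr
  have hrdeg : ∀ j, e ≤ j → r.coeff j = 0 := fun j hj => by
    simp [hr, hq1' j hj, h11 j hj]
  have hrhom : ∀ i j, i + j = q → (r.coeff i).IsHomogeneous j := fun i j hij => by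
    rw [hr, Polynomial.coeff_sub, Polynomial.coeff_C_mul]
    refine (hq3 i j hij).sub ?_
    rcases lt_or_ge 1 i with h | h
    · simpa [h12 i h] using isHomogeneous_zero _ _ _
    · have := hLhom.mul (h13 i (1 - i) (by omega))
      rwa [show q - 1 + (1 - i) = j by omega] at this
  have hoff : ∀ x, a x ≠ 0 → r.map (eval x) = 0 := by
    intro x hx
    refine Polynomial.eq_zero_of_natDegree_lt_card_of_eval_eq_zero' _
      (Finset.univ.filter fun t : F => eval (x + t • v) g = 0) ?_ ?_
    · intro t ht
      have ht : eval (x + t • v) g = 0 := by simpa using ht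
      have e1 := congrArg (fun P => (P.map (eval x)).eval t) hk
      have e2 := congrArg (fun P => (P.map (eval x)).eval t) hk1
      simp only [Polynomial.map_mul, Polynomial.eval_mul, eval_map_linePoly, ht, zero_mul,
        Polynomial.map_sub, Polynomial.map_pow, Polynomial.map_X, Polynomial.eval_sub,
        Polynomial.eval_pow, Polynomial.eval_X, hq, FiniteField.pow_card, pow_one] at e1 e2
      simp only [hr, Polynomial.map_sub, Polynomial.map_mul, Polynomial.map_C, hLeval,
        Polynomial.eval_sub, Polynomial.eval_mul, Polynomial.eval_C, hq,
        FiniteField.pow_card_sub_one_eq_one _ hx]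
      linear_combination e2 - e1
    · rw [← Fintype.card_subtype, ← Nat.card_eq_fintype_card, hline x hx]
      refine lt_of_le_of_lt (Polynomial.natDegree_map_le) ?_
      exact (Polynomial.natDegree_le_iff_coeff_eq_zero (n := e - 1)).mpr
        (fun j hj => hrdeg j (by omega)) |>.trans_lt (by omega)
  have hpos : ∀ j, 1 ≤ j → r.coeff j = 0 := by
    intro j hj
    rcases lt_or_ge q j with h | h
    · simp [hr, hq2 j h, h12 j (by omega)]
    · have hz : linForm a * r.coeff j = 0 := by
        refine ((isHomogeneous_linForm a).mul (hrhom j (q - j)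
          (by omega))).eq_zero_of_forall_eval_eq_zero_of_le_card ?_ ?_
        · intro x
          rw [map_mul, eval_linForm]
          by_cases hx : a x = 0
          · simp [hx]
          · rw [← Polynomial.coeff_map, hoff x hx]
            simp
        · rw [Cardinal.mk_fintype]
          exact_mod_cast (show 1 + (q - j) ≤ q by omega)
      exact (mul_eq_zero.mp hz).resolve_left (linForm_ne_zero ha)
  have hrC : r = Polynomial.C (r.coeff 0) :=
    Polynomial.eq_C_of_natDegree_le_zero
      (Polynomial.natDegree_le_iff_coeff_eq_zero.mpr fun j hj => hpos j hj)
  set ρ := eval w (r.coeff 0) with hρ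
  have hdvd : (linePoly v g).map (eval w) ∣ (Polynomial.X - Polynomial.C ρ) ^ q := by
    refine ⟨k.map (eval w), ?_⟩
    rw [sub_C_pow_card, ← Polynomial.map_mul, ← hk]
    have : rq.map (eval w) = Polynomial.C ρ := by
      have h := congrArg (fun P => P.map (eval w)) hrC
      simpa [hr, hLeval, hw, zero_pow (show q - 1 ≠ 0 by omega), hρ] using h
    simp [this, hq]
  obtain ⟨i, -, hi⟩ := (dvd_prime_pow (Polynomial.prime_X_sub_C ρ) q).mp hdvd
  have hdeg := natDegree_map_linePoly hg hv w
  have hi0 : i ≠ 0 := by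
    rintro rfl
    rw [pow_zero, associated_one_iff_isUnit] at hi
    rw [Polynomial.natDegree_eq_zero_of_isUnit hi] at hdeg
    omega
  refine ⟨ρ, fun t => ?_⟩
  rw [← eval_map_linePoly]
  obtain ⟨u, hu⟩ := hi
  have hu' : ((u : Polynomial F)).eval t ≠ 0 := by
    have := u.isUnit.map (Polynomial.evalRingHom t)
    exact this.ne_zero
  have := congrArg (Polynomial.eval t) hu
  rw [Polynomial.eval_mul, Polynomial.eval_pow, Polynomial.eval_sub, Polynomial.eval_X,
    Polynomial.eval_C] at this
  constructor
  · intro h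
    rw [h, zero_mul] at this
    exact sub_eq_zero.mp (pow_eq_zero_iff hi0 |>.mp this.symm)
  · rintro rfl
    rw [sub_self, zero_pow hi0] at this
    exact (mul_eq_zero.mp this).resolve_right hu'

end Pencil

namespace Pencil

variable {F V : Type*} [Field F] [AddCommGroup V] [Module F V]

/-- The set of zeros of `φ` in the hyperplane `a = 0`, as a subspace, when `φ` has at most one zero
on each line of that hyperplane in a direction where it does not vanish. -/
def zeroSubmodule (φ : V → F) (a : V →ₗ[F] F) (hφ0 : φ 0 = 0)
    (hφs : ∀ (c : F) x, φ x = 0 → φ (c • x) = 0)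
    (huniq : ∀ v, a v = 0 → φ v ≠ 0 → ∀ w, a w = 0 → ∃ ρ : F, ∀ t, φ (w + t • v) = 0 ↔ t = ρ) :
    Submodule F V where
  carrier := {u | a u = 0 ∧ φ u = 0}
  zero_mem' := ⟨map_zero a, hφ0⟩
  smul_mem' c x hx := ⟨by simp [hx.1], hφs c x hx.2⟩
  add_mem' := by
    rintro x y ⟨hx, hx'⟩ ⟨hy, hy'⟩
    refine ⟨by simp [hx, hy], ?_⟩
    by_contra hne
    obtain ⟨ρ, hρ⟩ := huniq (x + y) (by simp [hx, hy]) hne x hx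
    have h0 : (0 : F) = ρ := (hρ 0).mp (by simpa using hx')
    have h1 : (-1 : F) = ρ := (hρ (-1)).mp (by
      have := hφs (-1) y hy'
      convert this using 2
      module)
    exact neg_ne_zero.mpr one_ne_zero (h1.trans h0.symm)

variable [Fintype F]

open Classical in
theorem zero_on_line {φ : V → F} {e : ℕ} {P u v : V} (hP : φ P = 0)
    (h1 : ∀ s : F, Nat.card {t : F // φ (P + s • u + t • v) = 0} = e)
    (h2 : ∀ s : F, Nat.card {t : F // φ (P + t • (v + s • u)) = 0} = e) : φ (P + u) = 0 := by
  set I : F → F → ℕ := fun s t => if φ (P + s • u + t • v) = 0 then 1 else 0 with hI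
  have e1 : ∑ t : F, ∑ s : F, I s t = ∑ s : F, e := by
    rw [Finset.sum_comm]
    refine Finset.sum_congr rfl fun s _ => ?_
    rw [← h1 s, Nat.card_eq_fintype_card, Fintype.card_subtype, Finset.card_filter]
  have e2 : ∑ t : F, ∑ s : F, I (t * s) t = ∑ s : F, e := by
    rw [Finset.sum_comm]
    refine Finset.sum_congr rfl fun s _ => ?_
    rw [← h2 s, Nat.card_eq_fintype_card, Fintype.card_subtype, Finset.card_filter]
    refine Finset.sum_congr rfl fun t _ => ?_
    simp only [hI]
    congr 3
    module
  have e3 : ∑ t ∈ Finset.univ.erase (0 : F), ∑ s : F, I s t =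
      ∑ t ∈ Finset.univ.erase (0 : F), ∑ s : F, I (t * s) t := by
    refine Finset.sum_congr rfl fun t ht => ?_
    exact (Fintype.sum_equiv (Equiv.mulLeft₀ t (Finset.ne_of_mem_erase ht)) _ _
      fun s => rfl).symm
  have e4 : ∑ s : F, I s 0 = ∑ s : F, 1 := by
    rw [← Finset.add_sum_erase _ _ (Finset.mem_univ (0 : F))] at e1 e2
    have : ∑ s : F, I (0 * s) 0 = ∑ s : F, 1 :=
      Finset.sum_congr rfl fun s _ => by simp [hI, hP]
    omega
  have e5 := (Finset.sum_eq_sum_iff_of_le fun s _ => by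
    simp only [hI]; split_ifs <;> simp).mp e4 1 (Finset.mem_univ _)
  by_contra hne
  simp [hI, hne] at e5

open Classical in
theorem card_line_eq [Fintype V] {φ : V → F} {e : ℕ} {a : V →ₗ[F] F} {v : V} (hv : a v = 0)
    (hle : ∀ x, a x ≠ 0 → Nat.card {t : F // φ (x + t • v) = 0} ≤ e)
    (hcount : Fintype.card F * Nat.card {x : V // a x ≠ 0 ∧ φ x = 0} =
      e * Nat.card {x : V // a x ≠ 0}) {x : V} (hx : a x ≠ 0) :
    Nat.card {t : F // φ (x + t • v) = 0} = e := by
  have key : ∑ x ∈ Finset.univ.filter (fun x => a x ≠ 0), Nat.card {t : F // φ (x + t • v) = 0} =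
      ∑ x ∈ Finset.univ.filter (fun x => a x ≠ 0), e := by
    rw [Finset.sum_const, smul_eq_mul, mul_comm _ e, ← Fintype.card_subtype,
      ← Nat.card_eq_fintype_card, ← hcount]
    simp only [Nat.card_eq_fintype_card, Fintype.card_subtype, Finset.card_filter]
    rw [Finset.sum_filter, ← Finset.card_univ, ← smul_eq_mul, ← Finset.sum_const]
    have : ∀ x : V, (if a x ≠ 0 then ∑ t : F, (if φ (x + t • v) = 0 then 1 else 0) else 0) =
        ∑ t : F, if a (x + t • v) ≠ 0 ∧ φ (x + t • v) = 0 then 1 else 0 := by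
      intro x
      by_cases h : a x = 0 <;> simp [h, hv]
    rw [Finset.sum_congr rfl fun x _ => this x, Finset.sum_comm]
    refine Finset.sum_congr rfl fun t _ => ?_
    exact Fintype.sum_equiv (Equiv.addRight (t • v)) _ _ fun x => rfl
  exact (Finset.sum_eq_sum_iff_of_le fun x hx => hle x (by simpa using hx)).mp key x (by simpa)


theorem card_ker_mul [FiniteDimensional F V] {a : V →ₗ[F] F} (ha : a ≠ 0) :
    Nat.card {x : V // a x = 0} * Fintype.card F = Nat.card V := by
  have h := Module.Dual.finrank_ker_add_one_of_ne_zero ha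
  rw [← Nat.card_eq_fintype_card (α := F), Module.natCard_eq_pow_finrank (K := F) (V := V), ← h,
    pow_succ]
  congr 1
  exact Module.natCard_eq_pow_finrank (K := F) (V := LinearMap.ker a)

/-- A function with the maximal number of zeros on lines vanishes on a pencil of hyperplanes. -/
theorem exists_pencil {φ : V → F} {e : ℕ} (he : 1 ≤ e) {a : V →ₗ[F] F} (ha : a ≠ 0)
    (hφs : ∀ (c : F) x, φ x = 0 → φ (c • x) = 0)
    (hgood : ∃ v, a v = 0 ∧ φ v ≠ 0)
    (hline : ∀ v, a v = 0 → φ v ≠ 0 → ∀ x, a x ≠ 0 →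
      Nat.card {t : F // φ (x + t • v) = 0} = e)
    (huniq : ∀ v, a v = 0 → φ v ≠ 0 → ∀ w, a w = 0 → ∃ ρ : F, ∀ t, φ (w + t • v) = 0 ↔ t = ρ) :
    ∃ (b τ : V →ₗ[F] F) (S : Finset F) (x v : V), S.card = e ∧ b x = 1 ∧ b v = 0 ∧ τ x = 0 ∧
      τ v = 1 ∧ (∀ y, a y = 0 ↔ b y = 0) ∧ ∀ t ∈ S, ∀ y, τ y = t * b y → b y ≠ 0 → φ y = 0 := by
  classical
  obtain ⟨v, hav, hφv⟩ := hgood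
  obtain ⟨x, hax⟩ := DFunLike.ne_iff.mp ha
  simp only [LinearMap.zero_apply] at hax
  have hφ0 : φ 0 = 0 := by
    have : Nat.card {t : F // φ (x + t • v) = 0} ≠ 0 := by rw [hline v hav hφv x hax]; omega
    obtain ⟨t, ht⟩ := (Nat.card_ne_zero.mp this).1
    simpa using hφs 0 _ ht
  set B := zeroSubmodule φ a hφ0 hφs huniq with hB
  have memB (u : V) : u ∈ B ↔ a u = 0 ∧ φ u = 0 := Iff.rfl
  have hshift (P u : V) (hP : a P ≠ 0) (hP' : φ P = 0) (hu : u ∈ B) : φ (P + u) = 0 := by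
    refine zero_on_line (e := e) (v := v) hP' (fun s => ?_) fun s => ?_
    · exact hline v hav hφv _ (by simp [((memB u).mp hu).1, hP])
    · refine hline _ (by simp [((memB u).mp hu).1, hav]) (fun h => hφv ?_) _ hP
      have h1 : v + s • u ∈ B := (memB _).mpr ⟨by simp [((memB u).mp hu).1, hav], h⟩
      have h2 := B.sub_mem h1 (B.smul_mem s hu)
      rw [add_sub_cancel_right] at h2
      exact ((memB v).mp h2).2
  have hvB : v ∉ B ⊔ Submodule.span F {x} := by
    intro h
    obtain ⟨y, hy, z, hz, hyz⟩ := Submodule.mem_sup.mp h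
    obtain ⟨c, rfl⟩ := Submodule.mem_span_singleton.mp hz
    have h1 := congrArg a hyz
    rw [map_add, ((memB y).mp hy).1, hav, map_smul, zero_add, smul_eq_mul] at h1
    rw [(mul_eq_zero.mp h1).resolve_right hax, zero_smul, add_zero] at hyz
    exact hφv (hyz ▸ ((memB y).mp hy).2)
  obtain ⟨σ, hσv, hσ⟩ := Submodule.exists_le_ker_of_notMem hvB
  have hσB (u : V) (hu : u ∈ B) : σ u = 0 := hσ (Submodule.mem_sup_left hu)
  have hσx : σ x = 0 := hσ (Submodule.mem_sup_right (Submodule.mem_span_singleton_self x))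
  refine ⟨(a x)⁻¹ • a, (σ v)⁻¹ • σ, Finset.univ.filter fun t => φ (x + t • v) = 0, x, v,
    ?_, by simp [hax], by simp [hav], by simp [hσx], by simp [hσv], by simp [hax], ?_⟩
  · rw [← Fintype.card_subtype, ← Nat.card_eq_fintype_card, hline v hav hφv x hax]
  · intro t ht y hy hby
    have ht : φ (x + t • v) = 0 := by simpa using ht
    set c := ((a x)⁻¹ • a) y with hc
    have hay : a y = c * a x := by simp [hc]; field_simp
    have hσy : σ y = t * c * σ v := by
      rw [LinearMap.smul_apply, smul_eq_mul] at hy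
      field_simp at hy
      linear_combination hy
    have hw : a (c⁻¹ • y - (x + t • v)) = 0 := by
      simp [hay, hav]
      field_simp
      ring
    obtain ⟨ρ, hρ⟩ := huniq v hav hφv _ hw
    have h1 := hσB _ ((memB _).mpr ⟨by rw [map_add, hw]; simp [hav], (hρ ρ).mpr rfl⟩)
    have hρ0 : ρ = 0 := by
      simp only [map_add, map_sub, map_smul, hσy, hσx, smul_eq_mul, zero_add] at h1
      have h3 : c⁻¹ * (t * c * σ v) = t * σ v := by field_simp
      rw [h3, sub_self, zero_add] at h1
      exact (mul_eq_zero.mp h1).resolve_right hσv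
    have h2 := hshift (x + t • v) _ (by simp [hav, hax]) ht
      ((memB _).mpr ⟨hw, by simpa using (hρ 0).mpr hρ0.symm⟩)
    rw [add_sub_cancel] at h2
    simpa [smul_smul, hby] using hφs c _ h2

end Pencil

namespace Pencil

open MvPolynomial LinForm

variable {F : Type*} [Field F] {m : ℕ}

theorem not_dvd_of_not_proportional {l l' : MvPolynomial (Fin m) F} (hl : l.IsHomogeneous 1)
    (hl' : l'.IsHomogeneous 1) (h : ∀ c : F, l' ≠ c • l) : ¬ l ∣ l' := by
  intro hdvd
  obtain ⟨g, hg, rfl⟩ := exists_homogeneous_factor (e := 0) hl hl' hdvd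
  rw [← totalDegree_zero_iff_isHomogeneous, totalDegree_eq_zero_iff_eq_C] at hg
  refine h (coeff 0 g) ?_
  rw [smul_eq_C_mul, ← hg, mul_comm]

theorem eq_C_mul_prod {ι : Type*} [Fintype ι] {l : ι → MvPolynomial (Fin m) F}
    {f : MvPolynomial (Fin m) F} (hf0 : f ≠ 0) (hf : f.IsHomogeneous (Fintype.card ι))
    (hl : ∀ i, (l i).IsHomogeneous 1 ∧ l i ≠ 0)
    (hne : ∀ i j, i ≠ j → ∀ c : F, l j ≠ c • l i) (hdvd : ∀ i, l i ∣ f) :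
    ∃ c : F, c ≠ 0 ∧ f = C c * ∏ i, l i := by
  have hprod : ∏ i, l i ∣ f := by
    refine Fintype.prod_dvd_of_isRelPrime (fun i j hij => ?_) hdvd
    exact (irreducible_of_isHomogeneous_one (hl i).1 (hl i).2).isRelPrime_iff_not_dvd.mpr
      (not_dvd_of_not_proportional (hl i).1 (hl j).1 (hne i j hij))
  obtain ⟨k, hk⟩ := hprod
  have hPhom : (∏ i, l i).IsHomogeneous (Fintype.card ι) := by
    simpa using IsHomogeneous.prod Finset.univ l (fun _ => 1) fun i _ => (hl i).1
  have hP0 : ∏ i, l i ≠ 0 := fun h => hf0 (by rw [hk, h, zero_mul])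
  have hk0 : k ≠ 0 := fun h => hf0 (by rw [hk, h, mul_zero])
  have hdeg := congrArg totalDegree hk
  rw [totalDegree_mul_of_isDomain hP0 hk0, hf.totalDegree hf0, hPhom.totalDegree hP0,
    left_eq_add, totalDegree_eq_zero_iff_eq_C] at hdeg
  refine ⟨coeff 0 k, fun h => hk0 (by rw [hdeg, h, map_zero]), ?_⟩
  rw [← hdeg, hk, mul_comm]

variable [Fintype F]

theorem card_zeros {f : MvPolynomial (Fin m) F} {d : ℕ} (hf : f.IsHomogeneous d) (hd : 1 ≤ d) :
    Nat.card {x : Fin m → F // eval x f = 0} = (Fintype.card F - 1) * numPoints f + 1 := by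
  classical
  have hz : eval (0 : Fin m → F) f = 0 := by
    have := eval_smul_of_isHomogeneous hf 0 0
    rwa [smul_zero, zero_pow (by omega), zero_mul] at this
  have hscale (u : Fˣ) (x : Fin m → F) : eval (u • x) f = 0 ↔ eval x f = 0 := by
    rw [Units.smul_def, eval_smul_of_isHomogeneous hf]
    simp
  let φ : {p : Projectivization F (Fin m → F) // eval p.rep f = 0} × Fˣ →
      {x : {x : Fin m → F // eval x f = 0} // x ≠ ⟨0, hz⟩} := fun p =>
    ⟨⟨p.2 • p.1.1.rep, (hscale _ _).mpr p.1.2⟩, fun h => by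
      have h := congrArg Subtype.val h
      simp only [Units.smul_def] at h
      exact (smul_ne_zero p.2.ne_zero p.1.1.rep_nonzero) h⟩
  have hφ : Function.Bijective φ := by
    constructor
    · rintro ⟨⟨p, hp⟩, u⟩ ⟨⟨p', hp'⟩, u'⟩ h
      have h : u • p.rep = u' • p'.rep := congrArg (fun z => z.1.1) h
      have hpp : p = p' := by
        rw [← p.mk_rep, ← p'.mk_rep, Projectivization.mk_eq_mk_iff]
        exact ⟨u⁻¹ * u', by rw [mul_smul, ← h, inv_smul_smul]⟩
      subst hpp
      have huu : u = u' := by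
        apply Units.ext
        simp only [Units.smul_def] at h
        exact smul_left_injective F p.rep_nonzero h
      rw [huu]
    · rintro ⟨⟨x, hx⟩, hne⟩
      have hx0 : x ≠ 0 := fun h => hne (Subtype.ext h)
      obtain ⟨u, hu⟩ := Projectivization.exists_smul_eq_mk_rep F x hx0
      refine ⟨⟨⟨Projectivization.mk F x hx0, by rw [← hu, hscale]; exact hx⟩, u⁻¹⟩, ?_⟩
      apply Subtype.ext
      apply Subtype.ext
      simp [φ, ← hu]
  have h1 := Nat.card_congr (Equiv.ofBijective φ hφ)
  rw [Nat.card_prod, Nat.card_eq_fintype_card (α := Fˣ), Fintype.card_units,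
    Nat.card_eq_fintype_card (α := {x : {x : Fin m → F // eval x f = 0} // x ≠ ⟨0, hz⟩}),
    Fintype.card_subtype_compl, Fintype.card_subtype_eq] at h1
  have : 0 < Fintype.card {x : Fin m → F // eval x f = 0} := Fintype.card_pos_iff.mpr ⟨⟨0, hz⟩⟩
  rw [Nat.card_eq_fintype_card, numPoints, mul_comm]
  omega

theorem mul_NP_add_one (p n : ℕ) : p * NP (p + 1) n + 1 = (p + 1) ^ (n + 1) := by
  have := geom_sum_mul_add p (n + 1)
  rw [NP]
  linarith

theorem numPoints_eq_iff {f : MvPolynomial (Fin m) F} {d n : ℕ} (hf : f.IsHomogeneous d)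
    (hd : 1 ≤ d) :
    numPoints f = (d - 1) * Fintype.card F ^ n + NP (Fintype.card F) n ↔
      Nat.card {x : Fin m → F // eval x f = 0} =
        (Fintype.card F - 1) * ((d - 1) * Fintype.card F ^ n) + Fintype.card F ^ (n + 1) := by
  obtain ⟨p, hp⟩ : ∃ p, Fintype.card F = p + 1 := ⟨_, (Nat.sub_add_cancel Fintype.card_pos).symm⟩
  have hp0 : 0 < p := by have := Fintype.one_lt_card (α := F); omega
  rw [card_zeros hf hd, hp, Nat.add_sub_cancel, ← mul_NP_add_one p n, ← add_assoc,
    Nat.add_right_cancel_iff, ← mul_add, Nat.mul_right_inj hp0.ne']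

theorem card_line_le {g : MvPolynomial (Fin m) F} {e : ℕ} (hg : g.IsHomogeneous e)
    {v : Fin m → F} (hv : eval v g ≠ 0) (x : Fin m → F) :
    Nat.card {t : F // eval (x + t • v) g = 0} ≤ e := by
  classical
  by_contra! hlt
  have h0 := Polynomial.eq_zero_of_natDegree_lt_card_of_eval_eq_zero' ((linePoly v g).map (eval x))
    (Finset.univ.filter fun t : F => eval (x + t • v) g = 0)
    (fun t ht => by rw [eval_map_linePoly]; simpa using ht)
    (by rwa [natDegree_map_linePoly hg hv, ← Fintype.card_subtype, ← Nat.card_eq_fintype_card])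
  have h1 := congrArg (Polynomial.coeff · e) h0
  simp only [Polynomial.coeff_map, coeff_linePoly hg, eval_C, Polynomial.coeff_zero] at h1
  exact hv h1

theorem exists_lines_of_card {n e : ℕ} {f : MvPolynomial (Fin (n + 2)) F} (he : 1 ≤ e)
    (hf0 : f ≠ 0) (hsq : Squarefree f) (hhom : f.IsHomogeneous (e + 1)) (hthas : ThasEq f n)
    (hcard : Nat.card {x : Fin (n + 2) → F // eval x f = 0} =
      (Fintype.card F - 1) * (e * Fintype.card F ^ n) + Fintype.card F ^ (n + 1)) :
    ∃ (l : Fin (e + 1) → MvPolynomial (Fin (n + 2)) F) (c : F),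
      c ≠ 0 ∧
        (∀ i, (l i).IsHomogeneous 1 ∧ l i ≠ 0) ∧
        (∀ i j, i ≠ j → ∀ a : F, l j ≠ a • l i) ∧
        f = C c * ∏ i, l i ∧ Module.finrank F (Submodule.span F (Set.range l)) ≤ 2 := by
  classical
  obtain ⟨⟨W, hW, hWf⟩, hbig⟩ := hthas
  obtain ⟨a, ha, hWa⟩ := W.exists_le_ker_of_lt_top (lt_top_iff_ne_top.mpr fun h => by
    rw [h, finrank_top, Module.finrank_fin_fun] at hW
    omega)
  have hWker : W = LinearMap.ker a := by
    refine Submodule.eq_of_le_of_finrank_eq hWa ?_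
    have := Module.Dual.finrank_ker_add_one_of_ne_zero ha
    rw [Module.finrank_fin_fun] at this
    omega
  have hfa (x) (hx : a x = 0) : eval x f = 0 := hWf x (by rw [hWker]; exact hx)
  obtain ⟨p, hp⟩ : ∃ p, Fintype.card F = p + 1 := ⟨_, (Nat.sub_add_cancel Fintype.card_pos).symm⟩
  have hp0 : 0 < p := by have := Fintype.one_lt_card (α := F); omega
  have hV : Nat.card (Fin (n + 2) → F) = Fintype.card F ^ (n + 2) := by simp
  have hker : Nat.card {x // a x = 0} = Fintype.card F ^ (n + 1) := by
    have := card_ker_mul ha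
    rw [hV, pow_succ _ (n + 1)] at this
    exact Nat.eq_of_mul_eq_mul_right Fintype.card_pos this
  have he_lt : e < Fintype.card F := by
    have hlt : Nat.card {x : Fin (n + 2) → F // eval x f = 0} < Nat.card (Fin (n + 2) → F) := by
      rw [Nat.card_eq_fintype_card, Nat.card_eq_fintype_card]
      obtain ⟨x, hx⟩ : ∃ x : Fin (n + 2) → F, eval x f ≠ 0 := by
        by_contra! h
        exact hbig ⟨⊤, by simp, fun v _ => h v⟩
      exact Fintype.card_subtype_lt (x := x) hx
    rw [hcard, hV, hp, Nat.add_sub_cancel] at hlt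
    rw [hp]
    have hq : 0 < (p + 1) ^ n := by positivity
    have : p * e * (p + 1) ^ n < p * (p + 1) * (p + 1) ^ n := by
      rw [pow_succ _ (n + 1), pow_succ] at hlt
      nlinarith
    exact lt_of_mul_lt_mul_left (lt_of_mul_lt_mul_right this hq.le) hp0.le
  obtain ⟨g, hg, rfl⟩ := exists_homogeneous_factor (isHomogeneous_linForm a) hhom
    (linForm_dvd ha hhom he_lt hfa)
  have hgood : ∃ v, a v = 0 ∧ eval v g ≠ 0 := by
    by_contra! h
    have hdvd := linForm_dvd ha hg he_lt.le h
    exact (irreducible_of_isHomogeneous_one (isHomogeneous_linForm a)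
      (linForm_ne_zero ha)).not_isUnit (hsq _ (mul_dvd_mul_left _ hdvd))
  have hcompl : Nat.card {x // a x ≠ 0} = p * Fintype.card F ^ (n + 1) := by
    have h1 := Fintype.card_subtype_compl (fun x => a x = 0)
    rw [← Nat.card_eq_fintype_card, ← Nat.card_eq_fintype_card, ← Nat.card_eq_fintype_card, hV,
      hker, pow_succ _ (n + 1)] at h1
    rw [h1, hp]
    refine Nat.sub_eq_of_eq_add ?_
    ring
  have hoff : Nat.card {x // a x ≠ 0 ∧ eval x g = 0} = p * (e * Fintype.card F ^ n) := by
    have h1 : Nat.card {x : Fin (n + 2) → F // eval x (linForm a * g) = 0} =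
        Nat.card {x // a x = 0} + Nat.card {x // a x ≠ 0 ∧ eval x g = 0} := by
      simp only [Nat.card_eq_fintype_card, Fintype.card_subtype]
      rw [← Finset.card_union_of_disjoint]
      · congr 1
        ext x
        simp only [Finset.mem_filter, Finset.mem_univ, true_and, Finset.mem_union, map_mul,
          eval_linForm, mul_eq_zero]
        tauto
      · refine Finset.disjoint_filter.mpr fun x _ h => ?_
        tauto
    rw [hcard, hker, hp, Nat.add_sub_cancel] at h1
    rw [hp]
    omega
  have hline (v) (hv : a v = 0) (hv' : eval v g ≠ 0) (x) (hx : a x ≠ 0) :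
      Nat.card {t : F // eval (x + t • v) g = 0} = e := by
    refine card_line_eq (φ := fun x => eval x g) hv (fun x _ => card_line_le hg hv' x) ?_ hx
    rw [hoff, hcompl]
    ring
  obtain ⟨b, τ, S, x, v, hS, hbx, hbv, hτx, hτv, hab, hvan⟩ :=
    exists_pencil (φ := fun x => eval x g) he ha
      (fun c x hx => by rw [eval_smul_of_isHomogeneous hg, hx, mul_zero]) hgood hline
      fun v hv hv' w hw => existsUnique_zero hg he ha hv' (hline v hv hv') hw
  let A : Option S → ((Fin (n + 2) → F) →ₗ[F] F) := fun i => i.elim b fun t => τ - t.1 • b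
  have hAne (i j) (hij : i ≠ j) (c : F) : A j ≠ c • A i := by
    intro h
    have h1 := LinearMap.congr_fun h x
    have h2 := LinearMap.congr_fun h v
    rcases i with _ | i <;> rcases j with _ | j
    · exact hij rfl
    · simp [A, hbv, hτv] at h2
    · simp [A, hbx, hbv, hτx, hτv] at h1 h2
      rw [← h2, zero_mul, neg_zero] at h1
      exact one_ne_zero h1
    · simp [A, hbx, hbv, hτx, hτv] at h1 h2
      subst h2
      exact hij (by rw [Subtype.ext (by simpa using h1.symm : i.1 = j.1)])
  have hA0 (i) : A i ≠ 0 := by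
    rcases i with _ | i
    · exact fun h => by simpa [A, hbx] using LinearMap.congr_fun h x
    · exact fun h => by simpa [A, hbv, hτv] using LinearMap.congr_fun h v
  have hAvan (i) (y) (hy : A i y = 0) : eval y (linForm a * g) = 0 := by
    rw [map_mul, eval_linForm]
    by_cases hby : b y = 0
    · rw [(hab y).mpr hby, zero_mul]
    · rcases i with _ | t
      · exact absurd hy hby
      · rw [hvan t.1 t.2 y (by simpa [A, sub_eq_zero] using hy) hby, mul_zero]
  obtain ⟨L, hL⟩ := linForm_linear (F := F) (m := n + 2)
  have hcardS : Fintype.card (Option S) = e + 1 := by simp [hS]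
  have hlne (i j) (hij : i ≠ j) (c : F) : linForm (A j) ≠ c • linForm (A i) := by
    intro h
    rw [← hL, ← hL, ← map_smul] at h
    refine hAne i j hij c (LinearMap.ext fun y => ?_)
    rw [← eval_linForm, ← eval_linForm, ← hL, h, hL]
  have hl (i) : (linForm (A i)).IsHomogeneous 1 ∧ linForm (A i) ≠ 0 :=
    ⟨isHomogeneous_linForm _, linForm_ne_zero (hA0 i)⟩
  obtain ⟨c, hc, hfc⟩ := eq_C_mul_prod (l := fun i => linForm (A i)) hf0 (by rwa [hcardS]) hl hlne
    fun i => linForm_dvd (hA0 i) hhom he_lt (hAvan i)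
  let σ : Fin (e + 1) ≃ Option S := (Fintype.equivFinOfCardEq hcardS).symm
  refine ⟨(fun i => linForm (A i)) ∘ σ, c, hc, fun i => hl _,
    fun i j hij => hlne _ _ (σ.injective.ne hij), ?_, ?_⟩
  · rw [hfc]
    congr 1
    exact (σ.prod_comp fun i => linForm (A i)).symm
  rw [σ.surjective.range_comp]
  have hle : Submodule.span F (Set.range fun i => linForm (A i)) ≤
      Submodule.span F (({L b, L τ} : Finset (MvPolynomial (Fin (n + 2)) F)) :
        Set (MvPolynomial (Fin (n + 2)) F)) := by
    have hb : L b ∈ Submodule.span F (({L b, L τ} : Finset (MvPolynomial (Fin (n + 2)) F)) :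
        Set (MvPolynomial (Fin (n + 2)) F)) := Submodule.subset_span (by simp)
    have hτ : L τ ∈ Submodule.span F (({L b, L τ} : Finset (MvPolynomial (Fin (n + 2)) F)) :
        Set (MvPolynomial (Fin (n + 2)) F)) := Submodule.subset_span (by simp)
    rw [Submodule.span_le]
    rintro _ ⟨i, rfl⟩
    rcases i with _ | t
    · simpa [A, hL] using hb
    · change linForm (τ - t.1 • b) ∈ _
      rw [← hL, map_sub, map_smul]
      exact Submodule.sub_mem _ hτ (Submodule.smul_mem _ _ hb)
  exact (Submodule.finrank_mono hle).trans ((finrank_span_finset_le_card _).trans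
    Finset.card_le_two)

theorem card_zeros_of_pencil {n e : ℕ} (he : 1 ≤ e) {l : Fin (e + 1) → MvPolynomial (Fin (n + 2)) F}
    {c : F} (hc : c ≠ 0) (hl : ∀ i, (l i).IsHomogeneous 1 ∧ l i ≠ 0)
    (hne : ∀ i j, i ≠ j → ∀ a : F, l j ≠ a • l i)
    (hspan : Module.finrank F (Submodule.span F (Set.range l)) ≤ 2) :
    Nat.card {x : Fin (n + 2) → F // eval x (C c * ∏ i, l i) = 0} =
      (Fintype.card F - 1) * (e * Fintype.card F ^ n) + Fintype.card F ^ (n + 1) := by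
  classical
  obtain ⟨p, hp⟩ : ∃ p, Fintype.card F = p + 1 := ⟨_, (Nat.sub_add_cancel Fintype.card_pos).symm⟩
  choose a ha using fun i => exists_eq_linForm (hl i).1
  have hla (i x) : eval x (l i) = a i x := by rw [ha, eval_linForm]
  have ha0 (i) : a i ≠ 0 := by
    intro h
    refine (hl i).2 ?_
    rw [ha, h]
    simp [linForm]
  have hcommon (i j) (hij : i ≠ j) (x) (hi : a i x = 0) (hj : a j x = 0) (k) : a k x = 0 := by
    have hind : LinearIndependent F ![l i, l j] :=
      (LinearIndependent.pair_iff' (hl i).2).mpr fun t h => hne i j hij t h.symm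
    have hspan_eq : Submodule.span F (Set.range ![l i, l j]) = Submodule.span F (Set.range l) := by
      have : FiniteDimensional F (Submodule.span F (Set.range l)) :=
        FiniteDimensional.span_of_finite F (Set.finite_range l)
      refine Submodule.eq_of_le_of_finrank_le (Submodule.span_mono ?_) ?_
      · rintro _ ⟨s, rfl⟩
        fin_cases s <;> simp
      · rw [finrank_span_eq_card hind]
        simpa using hspan
    have hmem : l k ∈ Submodule.span F (Set.range ![l i, l j]) := by
      rw [hspan_eq]
      exact Submodule.subset_span ⟨k, rfl⟩
    rw [Matrix.range_cons, Matrix.range_cons, Matrix.range_empty, Set.union_empty,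
      Set.singleton_union, Submodule.mem_span_pair] at hmem
    obtain ⟨s, t, hst⟩ := hmem
    rw [← hla, ← hst]
    simp [smul_eval, hla, hi, hj]
  have hV : Nat.card (Fin (n + 2) → F) = Fintype.card F ^ (n + 2) := by simp
  have hker (i) : Nat.card {x // a i x = 0} = Fintype.card F ^ (n + 1) := by
    have := card_ker_mul (ha0 i)
    rw [hV, pow_succ _ (n + 1)] at this
    exact Nat.eq_of_mul_eq_mul_right Fintype.card_pos this
  have hinter : Nat.card {x // ∀ i, a i x = 0} = Fintype.card F ^ n := by
    have h01 : (0 : Fin (e + 1)) ≠ Fin.last e := by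
      intro h
      have := congrArg Fin.val h
      simp at this
      omega
    let β := (a (Fin.last e)).comp (LinearMap.ker (a 0)).subtype
    have hβ : β ≠ 0 := by
      intro h
      have hker_le : LinearMap.ker (a 0) ≤ LinearMap.ker (a (Fin.last e)) := fun x hx =>
        LinearMap.congr_fun h ⟨x, hx⟩
      have hdvd : linForm (a 0) ∣ linForm (a (Fin.last e)) :=
        linForm_dvd (ha0 0) (isHomogeneous_linForm _) Fintype.card_pos fun x hx => by
          rw [eval_linForm]
          exact hker_le hx
      rw [← ha, ← ha] at hdvd
      exact not_dvd_of_not_proportional (hl _).1 (hl _).1 (hne _ _ h01) hdvd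
    have h1 := card_ker_mul hβ
    have h2 : Nat.card (LinearMap.ker (a 0)) = Fintype.card F ^ (n + 1) := hker 0
    rw [h2, pow_succ] at h1
    rw [← Nat.eq_of_mul_eq_mul_right Fintype.card_pos h1]
    refine Nat.card_congr ⟨fun x => ⟨⟨x.1, x.2 0⟩, x.2 (Fin.last e)⟩,
      fun x => ⟨x.1.1, hcommon 0 (Fin.last e) h01 _ x.1.2 x.2⟩, fun x => rfl, fun x => rfl⟩
  simp only [Nat.card_eq_fintype_card, Fintype.card_subtype] at hker hinter ⊢
  set K := Finset.univ.filter fun x => ∀ i, a i x = 0 with hK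
  have hdecomp : (Finset.univ.filter fun x => eval x (C c * ∏ i, l i) = 0) =
      K ∪ Finset.univ.biUnion fun i => (Finset.univ.filter fun x => a i x = 0) \ K := by
    ext x
    simp only [Finset.mem_filter, Finset.mem_univ, true_and, map_mul, eval_C, map_prod, hla,
      mul_eq_zero, hc, false_or, Finset.prod_eq_zero_iff, Finset.mem_union, Finset.mem_biUnion,
      Finset.mem_sdiff]
    constructor
    · rintro ⟨i, hi⟩
      by_cases hx : x ∈ K
      · exact Or.inl hx
      · exact Or.inr ⟨i, hi, hx⟩
    · rintro (h | ⟨i, hi, -⟩)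
      · exact ⟨0, (Finset.mem_filter.mp h).2 0⟩
      · exact ⟨i, hi⟩
  have hsdiff (i) : ((Finset.univ.filter fun x => a i x = 0) \ K).card =
      p * Fintype.card F ^ n := by
    rw [Finset.card_sdiff_of_subset, hker, hinter, pow_succ, hp]
    · refine Nat.sub_eq_of_eq_add ?_
      ring
    · intro x hx
      simp only [hK, Finset.mem_filter, Finset.mem_univ, true_and] at hx ⊢
      exact hx i
  rw [hdecomp, Finset.card_union_of_disjoint, Finset.card_biUnion, hinter,
    Finset.sum_congr rfl fun i _ => hsdiff i]
  · simp only [Finset.sum_const, Finset.card_univ, Fintype.card_fin, smul_eq_mul, hp,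
      Nat.add_sub_cancel]
    ring
  · intro i _ j _ hij
    rw [Function.onFun, Finset.disjoint_left]
    intro x hx hx'
    simp only [Finset.mem_sdiff, Finset.mem_filter, Finset.mem_univ, true_and, hK] at hx hx'
    exact hx.2 (hcommon i j hij x hx.1 hx'.1)
  · rw [Finset.disjoint_left]
    intro x hx hx'
    simp only [Finset.mem_biUnion, Finset.mem_sdiff] at hx'
    obtain ⟨i, -, -, h⟩ := hx'
    exact h hx

end Pencil

theorem stmt10 {F : Type*} [Field F] [Fintype F] {n d : ℕ}
    (hn : 1 ≤ n) (hd : 2 ≤ d)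
    (f : MvPolynomial (Fin (n + 2)) F) (hf0 : f ≠ 0) (hsq : Squarefree f)
    (hhom : f.IsHomogeneous d) (hthas : ThasEq f n) :
    numPoints f = (d - 1) * Fintype.card F ^ n + NP (Fintype.card F) n ↔
      ∃ (l : Fin d → MvPolynomial (Fin (n + 2)) F) (c : F),
        c ≠ 0 ∧
        (∀ i, (l i).IsHomogeneous 1 ∧ l i ≠ 0) ∧
        (∀ i j, i ≠ j → ∀ a : F, l j ≠ a • l i) ∧
        f = MvPolynomial.C c * ∏ i, l i ∧
        Module.finrank F (Submodule.span F (Set.range l)) ≤ 2 := by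
  obtain ⟨e, rfl⟩ : ∃ e, d = e + 1 := ⟨d - 1, by omega⟩
  have he : 1 ≤ e := by omega
  rw [Pencil.numPoints_eq_iff hhom (by omega), Nat.add_sub_cancel]
  constructor
  · exact Pencil.exists_lines_of_card he hf0 hsq hhom hthas
  · rintro ⟨l, c, hc, hl, hne, rfl, hspan⟩
    exact Pencil.card_zeros_of_pencil he hc hl hne hspan
end
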